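/- arXiv:1608.05091 — 3 statements merged into one kernel-verified Lean document; each statement's English description precedes it below -/
import Mathlib

section
/- Let d ≥ 0, k ≥ 1, let 𝕋 = ℝ/ℤ carry its standard circular order, and let c₀, c₁, …, c_d be pairwise distinct points of 𝕋 arranged in cyclic order, giving the partition 𝕋 = ⋃_{i=0}^{d} [c_i, c_{i+1}) (indices mod d+1). Let f : 𝕋 → {0,1,…,d} be a proper coloring: f is constant on each arc [c_i, c_{i+1}) and distinct arcs receive distinct colors. Let (α₁,…,α_k) ∈ ℝ^k with at least one α_j irrational, let z ∈ 𝕋, and define φ : ℤ^k → {0,…,d} by φ(n₁,…,n_k) = f(z + n₁α₁ + ⋯ + n_kα_k). Let X_φ be the closure of the ℤ^k-orbit of φ in {0,…,d}^{ℤ^k} under the shift action (gω)(t) = ω(t+g). Then (ℤ^k, X_φ) is a minimal dynamical system, and there exists a circular order on X_φ whose interval topology equals the subspace topology of X_φ and for which every shift map is c-order preserving; in particular (ℤ^k, X_φ) is tame. -/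
/-- A circular order on a set `X`: a ternary relation satisfying cyclicity,
asymmetry, transitivity and totality. -/
structure CircularOrderRel (X : Type*) where
  rel : X → X → X → Prop
  cyclic : ∀ a b c, rel a b c → rel b c a
  asymm : ∀ a b c, rel a b c → ¬ rel a c b
  trans : ∀ a b c d, rel a b c → rel a c d → rel a b d
  total : ∀ a b c : X, a ≠ b → b ≠ c → a ≠ c → rel a b c ∨ rel a c b

/-- The interval topology of a ternary (circular order) relation: the topology
generated by the open intervals `(a,b) = {x | [a,x,b]}` for distinct `a, b`. -/
def intervalTopology {X : Type*} (r : X → X → X → Prop) : TopologicalSpace X :=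
  TopologicalSpace.generateFrom {s | ∃ a b : X, a ≠ b ∧ s = {x | r a x b}}

/-- The closed interval `[a,c]` of a circular order relation. -/
def closedArc {X : Type*} (r : X → X → X → Prop) (a c : X) : Set X :=
  {a, c} ∪ {x | r a x c}

/-- A map between circularly ordered sets is c-order preserving (COP). -/
def IsCOP {X Y : Type*} (r : X → X → X → Prop) (r' : Y → Y → Y → Prop)
    (f : X → Y) : Prop :=
  (∀ a b c : X, r a b c → f a ≠ f b → f b ≠ f c → f a ≠ f c → r' (f a) (f b) (f c)) ∧
  (∀ a c : X, f a = f c →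
    (∀ x ∈ closedArc r a c, f x = f a) ∨ (∀ x ∈ closedArc r c a, f x = f a))

/-- A sequence of real valued functions is independent. -/
def IsIndepSeq {X : Type*} (f : ℕ → X → ℝ) : Prop :=
  ∃ a b : ℝ, a < b ∧ ∀ P M : Finset ℕ, Disjoint P M →
    ((⋂ n ∈ P, {x | f n x < a}) ∩ (⋂ n ∈ M, {x | b < f n x})).Nonempty

/-- The standard circular order on `{0, 1, …, n-1}` (integers mod `n`). -/
def cyclicFin {n : ℕ} (i j k : Fin n) : Prop :=
  (i < j ∧ j < k) ∨ (j < k ∧ k < i) ∨ (k < i ∧ i < j)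

/-- A tuple `(x 0, …, x (n-1))` is a cycle in a circularly ordered set. -/
def IsCycle {X : Type*} (r : X → X → X → Prop) {n : ℕ} (x : Fin n → X) : Prop :=
  (∀ i j k : Fin n, cyclicFin i j k → x i ≠ x j → x j ≠ x k → x i ≠ x k →
      r (x i) (x j) (x k)) ∧
  (∀ i k : Fin n, x i = x k →
    (∀ j : Fin n, (j = i ∨ j = k ∨ cyclicFin i j k) → x j = x i) ∨
    (∀ j : Fin n, (j = i ∨ j = k ∨ cyclicFin k j i) → x j = x i))

/-- `f` has cyclic variation at most `v`. -/
def CyclicVariationLe {X : Type*} (r : X → X → X → Prop) (f : X → ℝ) (v : ℝ) : Prop :=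
  ∀ (n : ℕ) (x : Fin (n + 1) → X), IsCycle r x →
    ∑ i : Fin (n + 1), |f (x i) - f (x (i + 1))| ≤ v

/-- The representative in `[0,1)` of a point of the circle `𝕋 = ℝ/ℤ`. -/
noncomputable def circleRep (x : AddCircle (1 : ℝ)) : ℝ :=
  haveI : Fact ((0 : ℝ) < 1) := ⟨one_pos⟩
  ((AddCircle.equivIco 1 0 x : Set.Ico (0 : ℝ) (0 + 1)) : ℝ)

/-- The standard circular order on the circle `𝕋 = ℝ/ℤ`:
`[x,y,z]` iff `(y'-x')(z'-y')(z'-x') > 0` for the representatives in `[0,1)`. -/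
def stdCircRel (x y z : AddCircle (1 : ℝ)) : Prop :=
  0 < (circleRep y - circleRep x) * (circleRep z - circleRep y) *
    (circleRep z - circleRep x)

/-- The arc `[a, b) = {a} ∪ (a,b)` on the circle. -/
def circleArc (a b : AddCircle (1 : ℝ)) : Set (AddCircle (1 : ℝ)) :=
  insert a {x | stdCircRel a x b}

/-- The shift action of `ℤ^k` on `Δ^{ℤ^k}`: `(g ω) t = ω (t + g)`. -/
def shiftZk {k : ℕ} {Δ : Type*} (g : Fin k → ℤ) (ω : (Fin k → ℤ) → Δ) :
    (Fin k → ℤ) → Δ :=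
  fun t => ω (t + g)

open Filter Topology

/-- The integer part of `u` (for `true`) and its left-continuous version (for `false`). -/
noncomputable def sidedFloor (s : Bool) (u : ℝ) : ℤ := if s then ⌊u⌋ else ⌈u⌉ - 1

lemma sidedFloor_add_int (s : Bool) (u : ℝ) (m : ℤ) :
    sidedFloor s (u + m) = sidedFloor s u + m := by
  cases s
  · simp [sidedFloor]
    ring
  · simp [sidedFloor]

lemma sidedFloor_le_of_lt {u v : ℝ} (h : u < v) (s t : Bool) :
    sidedFloor s u ≤ sidedFloor t v := by
  have h1 : sidedFloor s u ≤ ⌊u⌋ := by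
    cases s
    · simp only [sidedFloor, Bool.false_eq_true, if_false]
      linarith [Int.ceil_le_floor_add_one u]
    · simp [sidedFloor]
  have h2 : ⌈v⌉ - 1 ≤ sidedFloor t v := by
    cases t
    · simp [sidedFloor]
    · simp only [sidedFloor, if_true]
      linarith [Int.ceil_le_floor_add_one v]
  have h3 : ⌊u⌋ < ⌈v⌉ := Int.lt_ceil.2 ((Int.floor_le u).trans_lt h)
  omega

lemma sidedFloor_false_le_true (u : ℝ) : sidedFloor false u ≤ sidedFloor true u := by
  simp only [sidedFloor, Bool.false_eq_true, if_false, if_true]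
  linarith [Int.ceil_le_floor_add_one u]

lemma sidedFloor_true_eq_false_of_not_int {u : ℝ} (h : ∀ m : ℤ, u ≠ m) :
    sidedFloor true u = sidedFloor false u := by
  simp only [sidedFloor, Bool.false_eq_true, if_false, if_true]
  have : ⌈u⌉ = ⌊u⌋ + 1 := by
    rw [Int.ceil_eq_iff]
    push_cast
    refine ⟨?_, (Int.lt_floor_add_one u).le⟩
    rw [add_sub_cancel_right]
    exact lt_of_le_of_ne (Int.floor_le u) (Ne.symm (h _))
  omega

lemma sidedFloor_true_int (m : ℤ) : sidedFloor true (m : ℝ) = sidedFloor false (m : ℝ) + 1 := by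
  simp [sidedFloor]

lemma sidedFloor_eventually_right (u : ℝ) :
    ∀ᶠ v in 𝓝[>] u, ∀ s, sidedFloor s v = sidedFloor true u := by
  filter_upwards [Ioo_mem_nhdsGT (Int.lt_floor_add_one u)] with v hv s
  have h0 := Int.floor_le u
  cases s
  · simp only [sidedFloor, Bool.false_eq_true, if_false, if_true, sub_eq_iff_eq_add]
    rw [Int.ceil_eq_iff]
    push_cast
    exact ⟨by linarith [hv.1], hv.2.le⟩
  · simp only [sidedFloor, if_true]
    rw [Int.floor_eq_iff]
    exact ⟨by linarith [hv.1], hv.2⟩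

lemma sidedFloor_eventually_left (u : ℝ) :
    ∀ᶠ v in 𝓝[<] u, ∀ s, sidedFloor s v = sidedFloor false u := by
  have h1 : ((⌈u⌉ - 1 : ℤ) : ℝ) < u := Int.lt_ceil.1 (by omega)
  have h2 := Int.le_ceil u
  filter_upwards [Ioo_mem_nhdsLT h1] with v hv s
  have h3 := hv.1
  have h4 := hv.2
  push_cast at h3
  cases s
  · simp only [sidedFloor, Bool.false_eq_true, if_false, sub_left_inj]
    rw [Int.ceil_eq_iff]
    exact ⟨h3, by linarith⟩
  · simp only [sidedFloor, Bool.false_eq_true, if_false, if_true]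
    rw [Int.floor_eq_iff]
    push_cast
    exact ⟨h3.le, by linarith⟩

/-- The monotone step function with unit jumps at the points of `e i + ℤ`, in its
right-continuous (`true`) and left-continuous (`false`) versions. -/
noncomputable def stepSum {d : ℕ} (e : Fin (d + 1) → ℝ) (s : Bool) (x : ℝ) : ℤ :=
  ∑ i, sidedFloor s (x - e i)

section StepSum

variable {d : ℕ} (e : Fin (d + 1) → ℝ)

lemma stepSum_add_int (s : Bool) (x : ℝ) (m : ℤ) :
    stepSum e s (x + m) = stepSum e s x + m * (d + 1) := by
  simp only [stepSum, add_sub_right_comm, sidedFloor_add_int, Finset.sum_add_distrib]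
  simp
  ring

lemma stepSum_add_one (s : Bool) (x : ℝ) :
    stepSum e s (x + 1) = stepSum e s x + (d + 1) := by
  simpa using stepSum_add_int e s x 1

lemma stepSum_le_of_lt {x y : ℝ} (h : x < y) (s t : Bool) : stepSum e s x ≤ stepSum e t y :=
  Finset.sum_le_sum fun _ _ => sidedFloor_le_of_lt (by linarith) s t

lemma stepSum_false_le_true (x : ℝ) : stepSum e false x ≤ stepSum e true x :=
  Finset.sum_le_sum fun _ _ => sidedFloor_false_le_true _

lemma stepSum_eventually_right (x : ℝ) :
    ∀ᶠ y in 𝓝[>] x, ∀ s, stepSum e s y = stepSum e true x := by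
  have h : ∀ i, ∀ᶠ y in 𝓝[>] x, ∀ s, sidedFloor s (y - e i) = sidedFloor true (x - e i) := by
    intro i
    have ht : Tendsto (fun y => y - e i) (𝓝[>] x) (𝓝[>] (x - e i)) := by
      refine tendsto_nhdsWithin_of_tendsto_nhds_of_eventually_within _ ?_ ?_
      · exact ((continuous_id.sub continuous_const).tendsto x).mono_left nhdsWithin_le_nhds
      · filter_upwards [self_mem_nhdsWithin] with y hy
        exact sub_lt_sub_right (Set.mem_Ioi.1 hy) _
    exact ht.eventually (sidedFloor_eventually_right _)
  filter_upwards [eventually_all.2 h] with y hy s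
  exact Finset.sum_congr rfl fun i _ => hy i s

lemma stepSum_eventually_left (x : ℝ) :
    ∀ᶠ y in 𝓝[<] x, ∀ s, stepSum e s y = stepSum e false x := by
  have h : ∀ i, ∀ᶠ y in 𝓝[<] x, ∀ s, sidedFloor s (y - e i) = sidedFloor false (x - e i) := by
    intro i
    have ht : Tendsto (fun y => y - e i) (𝓝[<] x) (𝓝[<] (x - e i)) := by
      refine tendsto_nhdsWithin_of_tendsto_nhds_of_eventually_within _ ?_ ?_
      · exact ((continuous_id.sub continuous_const).tendsto x).mono_left nhdsWithin_le_nhds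
      · filter_upwards [self_mem_nhdsWithin] with y hy
        exact sub_lt_sub_right (Set.mem_Iio.1 hy) _
    exact ht.eventually (sidedFloor_eventually_left _)
  filter_upwards [eventually_all.2 h] with y hy s
  exact Finset.sum_congr rfl fun i _ => hy i s

variable {e}

lemma stepSum_true_le_false_add_one (he : ∀ i j, ∀ m : ℤ, e i - e j = m → i = j) (x : ℝ) :
    stepSum e true x ≤ stepSum e false x + 1 := by
  by_cases h : ∃ i, ∃ m : ℤ, x - e i = m
  · obtain ⟨i, m, hm⟩ := h
    have hj : ∀ j ∈ Finset.univ.erase i,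
        sidedFloor true (x - e j) = sidedFloor false (x - e j) := by
      intro j hj
      refine sidedFloor_true_eq_false_of_not_int fun l hl => Finset.ne_of_mem_erase hj ?_
      exact he j i (m - l) (by push_cast; linarith)
    rw [stepSum, stepSum, ← Finset.add_sum_erase _ _ (Finset.mem_univ i),
      ← Finset.add_sum_erase _ _ (Finset.mem_univ i), Finset.sum_congr rfl hj, hm,
      sidedFloor_true_int]
    linarith
  · push Not at h
    have : stepSum e true x = stepSum e false x :=
      Finset.sum_congr rfl fun i _ => sidedFloor_true_eq_false_of_not_int (h i)
    omega

lemma stepSum_false_add_one_le_true (i : Fin (d + 1)) :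
    stepSum e false (e i) + 1 ≤ stepSum e true (e i) := by
  rw [stepSum, stepSum, ← Finset.add_sum_erase _ _ (Finset.mem_univ i),
    ← Finset.add_sum_erase _ _ (Finset.mem_univ i)]
  have h1 : sidedFloor true (e i - e i) = sidedFloor false (e i - e i) + 1 := by
    simpa using sidedFloor_true_int 0
  have h2 : ∑ j ∈ Finset.univ.erase i, sidedFloor false (e i - e j) ≤
      ∑ j ∈ Finset.univ.erase i, sidedFloor true (e i - e j) :=
    Finset.sum_le_sum fun _ _ => sidedFloor_false_le_true _
  omega

end StepSum

section CodeLift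

variable {d : ℕ} {I : Type*} [AddCommGroup I] (e : Fin (d + 1) → ℝ) (θ : I →+ ℝ)

/-- The integer-valued lift of the (one-sided) coding of the point `x`. -/
noncomputable def codeLift (s : Bool) (x : ℝ) : I → ℤ := fun n => stepSum e s (x + θ n)

/-- All lifted codings. -/
def liftSet : Set (I → ℤ) := {P | ∃ s x, P = codeLift e θ s x}

lemma codeLift_mem_liftSet (s : Bool) (x : ℝ) : codeLift e θ s x ∈ liftSet e θ := ⟨s, x, rfl⟩

lemma codeLift_add_int (s : Bool) (x : ℝ) (m : ℤ) :
    codeLift e θ s (x + m) = codeLift e θ s x + fun _ => m * (d + 1) := by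
  funext n
  simp only [codeLift, Pi.add_apply, ← stepSum_add_int]
  congr 1
  ring

lemma codeLift_add_apply (s : Bool) (x : ℝ) (g n : I) :
    codeLift e θ s x (n + g) = codeLift e θ s (x + θ g) n := by
  simp only [codeLift, map_add]
  congr 1
  ring

lemma codeLift_le_of_lt {x y : ℝ} (h : x < y) (s t : Bool) :
    codeLift e θ s x ≤ codeLift e θ t y :=
  fun _ => stepSum_le_of_lt e (by linarith) s t

lemma codeLift_false_le_true (x : ℝ) : codeLift e θ false x ≤ codeLift e θ true x :=
  fun _ => stepSum_false_le_true e _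

lemma liftSet_chain {P Q : I → ℤ} (hP : P ∈ liftSet e θ) (hQ : Q ∈ liftSet e θ) :
    P ≤ Q ∨ Q ≤ P := by
  obtain ⟨s, x, rfl⟩ := hP
  obtain ⟨t, y, rfl⟩ := hQ
  rcases lt_trichotomy x y with h | rfl | h
  · exact Or.inl (codeLift_le_of_lt e θ h _ _)
  · cases s <;> cases t
    · exact Or.inl le_rfl
    · exact Or.inl (codeLift_false_le_true e θ x)
    · exact Or.inr (codeLift_false_le_true e θ x)
    · exact Or.inl le_rfl
  · exact Or.inr (codeLift_le_of_lt e θ h _ _)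

lemma liftSet_add {P : I → ℤ} (hP : P ∈ liftSet e θ) (m : ℤ) :
    (P + fun _ => m * ((d : ℤ) + 1)) ∈ liftSet e θ := by
  obtain ⟨s, x, rfl⟩ := hP
  exact ⟨s, x + m, (codeLift_add_int e θ s x m).symm⟩

lemma liftSet_shift {P : I → ℤ} (hP : P ∈ liftSet e θ) (g : I) :
    (fun n => P (n + g)) ∈ liftSet e θ := by
  obtain ⟨s, x, rfl⟩ := hP
  exact ⟨s, x + θ g, funext fun n => codeLift_add_apply e θ s x g n⟩

lemma tendsto_codeLift_right (x : ℝ) (s : ℝ → Bool) :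
    Tendsto (fun y => codeLift e θ (s y) y) (𝓝[>] x) (𝓝 (codeLift e θ true x)) := by
  refine tendsto_pi_nhds.2 fun n => tendsto_nhds_of_eventually_eq ?_
  have ht : Tendsto (fun y => y + θ n) (𝓝[>] x) (𝓝[>] (x + θ n)) := by
    refine tendsto_nhdsWithin_of_tendsto_nhds_of_eventually_within _ ?_ ?_
    · exact ((continuous_id.add continuous_const).tendsto x).mono_left nhdsWithin_le_nhds
    · filter_upwards [self_mem_nhdsWithin] with y hy
      exact add_lt_add_left (Set.mem_Ioi.1 hy) _
  filter_upwards [ht.eventually (stepSum_eventually_right e _)] with y hy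
  exact hy _

lemma tendsto_codeLift_left (x : ℝ) (s : ℝ → Bool) :
    Tendsto (fun y => codeLift e θ (s y) y) (𝓝[<] x) (𝓝 (codeLift e θ false x)) := by
  refine tendsto_pi_nhds.2 fun n => tendsto_nhds_of_eventually_eq ?_
  have ht : Tendsto (fun y => y + θ n) (𝓝[<] x) (𝓝[<] (x + θ n)) := by
    refine tendsto_nhdsWithin_of_tendsto_nhds_of_eventually_within _ ?_ ?_
    · exact ((continuous_id.add continuous_const).tendsto x).mono_left nhdsWithin_le_nhds
    · filter_upwards [self_mem_nhdsWithin] with y hy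
      exact add_lt_add_left (Set.mem_Iio.1 hy) _
  filter_upwards [ht.eventually (stepSum_eventually_left e _)] with y hy
  exact hy _

lemma isCompact_codeLift_Icc (a b : ℝ) :
    IsCompact ((fun q : Bool × ℝ => codeLift e θ q.1 q.2) '' (Set.univ ×ˢ Set.Icc a b)) := by
  rw [isCompact_iff_ultrafilter_le_nhds]
  intro U hU
  set ψ : Bool × ℝ → I → ℤ := fun q => codeLift e θ q.1 q.2 with hψ
  set S : Set (Bool × ℝ) := Set.univ ×ˢ Set.Icc a b with hS
  have hne : NeBot (comap ψ U ⊓ 𝓟 S) := by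
    refine comap_inf_principal_neBot_of_image_mem U.neBot ?_
    exact le_principal_iff.1 hU
  set V : Ultrafilter (Bool × ℝ) := Ultrafilter.of (comap ψ U ⊓ 𝓟 S) with hV
  have hVle : (V : Filter (Bool × ℝ)) ≤ comap ψ U ⊓ 𝓟 S := Ultrafilter.of_le _
  have hVS : S ∈ V := le_principal_iff.1 (hVle.trans inf_le_right)
  have hVU : V.map ψ = U := by
    refine Ultrafilter.coe_le_coe.1 ?_
    exact (map_mono (hVle.trans inf_le_left)).trans map_comap_le
  have hmap : (V.map Prod.snd : Filter ℝ) ≤ 𝓟 (Set.Icc a b) := by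
    refine le_principal_iff.2 ?_
    exact V.sets_of_superset hVS fun q hq => hq.2
  obtain ⟨x, hx, hxV⟩ := isCompact_iff_ultrafilter_le_nhds.1 isCompact_Icc (V.map Prod.snd) hmap
  have hsnd : Tendsto Prod.snd (V : Filter (Bool × ℝ)) (𝓝 x) := hxV
  suffices h : ∃ s, Tendsto ψ V (𝓝 (codeLift e θ s x)) by
    obtain ⟨s, hs⟩ := h
    refine ⟨_, ⟨(s, x), ⟨Set.mem_univ _, hx⟩, rfl⟩, ?_⟩
    rw [← hVU]
    exact hs
  have hcases : ∀ᶠ q in (V : Filter (Bool × ℝ)), q.2 < x ∨ x < q.2 ∨ q = (false, x) ∨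
      q = (true, x) := by
    refine Eventually.of_forall fun ⟨s, y⟩ => ?_
    rcases lt_trichotomy y x with h | rfl | h
    · exact Or.inl h
    · cases s <;> simp
    · exact Or.inr (Or.inl h)
  have key : ∀ (l : Filter ℝ) (Q : I → ℤ),
      (∀ s : ℝ → Bool, Tendsto (fun y => codeLift e θ (s y) y) l (𝓝 Q)) →
      Tendsto Prod.snd (V : Filter (Bool × ℝ)) l → Tendsto ψ V (𝓝 Q) := by
    intro l Q h1 h2
    have h3 : ∀ s, Tendsto (fun q : Bool × ℝ => codeLift e θ s q.2) V (𝓝 Q) :=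
      fun s => (h1 fun _ => s).comp h2
    intro N hN
    refine mem_map.2 ?_
    filter_upwards [mem_map.1 (h3 true hN), mem_map.1 (h3 false hN)] with q ht hf
    obtain ⟨s, y⟩ := q
    cases s
    · exact hf
    · exact ht
  rcases Ultrafilter.eventually_or.1 hcases with h | h
  · refine ⟨false, key (𝓝[<] x) _ (tendsto_codeLift_left e θ x) ?_⟩
    exact tendsto_nhdsWithin_of_tendsto_nhds_of_eventually_within _ hsnd h
  rcases Ultrafilter.eventually_or.1 h with h | h
  · refine ⟨true, key (𝓝[>] x) _ (tendsto_codeLift_right e θ x) ?_⟩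
    exact tendsto_nhdsWithin_of_tendsto_nhds_of_eventually_within _ hsnd h
  rcases Ultrafilter.eventually_or.1 h with h | h
  · exact ⟨false, tendsto_nhds_of_eventually_eq (h.mono fun q hq => by rw [hq])⟩
  · exact ⟨true, tendsto_nhds_of_eventually_eq (h.mono fun q hq => by rw [hq])⟩

lemma isCompact_liftSet_Icc (P Q : I → ℤ) (hP : P ∈ liftSet e θ) (hQ : Q ∈ liftSet e θ) :
    IsCompact (liftSet e θ ∩ Set.Icc P Q) := by
  obtain ⟨s, x, rfl⟩ := hP
  obtain ⟨t, y, rfl⟩ := hQ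
  have hpos : ∀ A : I → ℤ, ¬ (A + fun _ => ((1 : ℤ) : ℤ) * ((d : ℤ) + 1)) ≤ A := by
    intro A h
    have := h 0
    simp only [Pi.add_apply] at this
    omega
  have heq : liftSet e θ ∩ Set.Icc (codeLift e θ s x) (codeLift e θ t y) =
      ((fun q : Bool × ℝ => codeLift e θ q.1 q.2) '' (Set.univ ×ˢ Set.Icc (x - 1) (y + 1))) ∩
        Set.Icc (codeLift e θ s x) (codeLift e θ t y) := by
    ext P
    refine and_congr_left fun hP => ⟨?_, ?_⟩
    · rintro ⟨r, w, rfl⟩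
      refine ⟨(r, w), ⟨Set.mem_univ _, ?_, ?_⟩, rfl⟩
      · by_contra! hlt
        have h1 := codeLift_le_of_lt e θ (show w + (1 : ℤ) < x by push_cast; simp at hlt; linarith)
          r s
        rw [codeLift_add_int] at h1
        exact hpos _ (h1.trans hP.1)
      · by_contra! hlt
        have h1 := codeLift_le_of_lt e θ (show y + (1 : ℤ) < w by push_cast; simp at hlt; linarith)
          t r
        rw [codeLift_add_int] at h1
        exact hpos _ (h1.trans hP.2)
    · rintro ⟨⟨r, w⟩, -, rfl⟩
      exact ⟨r, w, rfl⟩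
  rw [heq]
  exact (isCompact_codeLift_Icc e θ _ _).inter_right isClosed_Icc

variable {e θ}

lemma frequently_translate_right (hθ : Dense {w | ∃ n : I, ∃ m : ℤ, w = θ n + m}) (x y : ℝ) :
    ∃ᶠ w in 𝓝[>] y, ∃ n : I, ∃ m : ℤ, w = x + θ n + m := by
  rw [frequently_iff]
  intro U hU
  obtain ⟨u, hu, hsub⟩ := mem_nhdsGT_iff_exists_Ioo_subset.1 hU
  obtain ⟨w, ⟨n, m, rfl⟩, h1, h2⟩ := hθ.exists_between (sub_lt_sub_right (Set.mem_Ioi.1 hu) x)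
  refine ⟨x + θ n + m, hsub ⟨by linarith, by linarith⟩, n, m, rfl⟩

lemma frequently_translate_left (hθ : Dense {w | ∃ n : I, ∃ m : ℤ, w = θ n + m}) (x y : ℝ) :
    ∃ᶠ w in 𝓝[<] y, ∃ n : I, ∃ m : ℤ, w = x + θ n + m := by
  rw [frequently_iff]
  intro U hU
  obtain ⟨u, hu, hsub⟩ := mem_nhdsLT_iff_exists_Ioo_subset.1 hU
  obtain ⟨w, ⟨n, m, rfl⟩, h1, h2⟩ := hθ.exists_between (sub_lt_sub_right (Set.mem_Iio.1 hu) x)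
  refine ⟨x + θ n + m, hsub ⟨by linarith, by linarith⟩, n, m, rfl⟩

lemma eventually_stepSum_sub_eq (δ y : ℝ) (s t r : Bool) (l : Filter ℝ)
    (hl : l = if r then 𝓝[>] y else 𝓝[<] y) :
    ∀ᶠ w in l, stepSum e t (w + δ) - stepSum e s w = stepSum e r (y + δ) - stepSum e r y := by
  cases r
  · simp only [Bool.false_eq_true, if_false] at hl
    have ht : Tendsto (fun w => w + δ) (𝓝[<] y) (𝓝[<] (y + δ)) := by
      refine tendsto_nhdsWithin_of_tendsto_nhds_of_eventually_within _ ?_ ?_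
      · exact ((continuous_id.add continuous_const).tendsto y).mono_left nhdsWithin_le_nhds
      · filter_upwards [self_mem_nhdsWithin] with w hw
        exact add_lt_add_left (Set.mem_Iio.1 hw) _
    rw [hl]
    filter_upwards [stepSum_eventually_left e y, ht.eventually (stepSum_eventually_left e _)]
      with w h1 h2
    rw [h1, h2]
  · simp only [if_true] at hl
    have ht : Tendsto (fun w => w + δ) (𝓝[>] y) (𝓝[>] (y + δ)) := by
      refine tendsto_nhdsWithin_of_tendsto_nhds_of_eventually_within _ ?_ ?_
      · exact ((continuous_id.add continuous_const).tendsto y).mono_left nhdsWithin_le_nhds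
      · filter_upwards [self_mem_nhdsWithin] with w hw
        exact add_lt_add_left (Set.mem_Ioi.1 hw) _
    rw [hl]
    filter_upwards [stepSum_eventually_right e y, ht.eventually (stepSum_eventually_right e _)]
      with w h1 h2
    rw [h1, h2]

lemma not_codeLift_congr (hd : d ≠ 0) (he : ∀ i j, ∀ m : ℤ, e i - e j = m → i = j)
    (hθ : Dense {w | ∃ n : I, ∃ m : ℤ, w = θ n + m}) {x y : ℝ} (s t : Bool)
    (hxy : x < y) (hyx : y < x + 1) :
    ¬ ∀ n, (d + 1 : ℤ) ∣ codeLift e θ t y n - codeLift e θ s x n := by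
  intro h
  set δ := y - x with hδ
  have hdvd : ∀ w, (∃ n : I, ∃ m : ℤ, w = x + θ n + m) →
      (d + 1 : ℤ) ∣ stepSum e t (w + δ) - stepSum e s w := by
    rintro w ⟨n, m, rfl⟩
    have h1 := h n
    simp only [codeLift] at h1
    rw [show x + θ n + m + δ = y + θ n + m by rw [hδ]; ring, stepSum_add_int, stepSum_add_int]
    convert h1 using 1
    ring
  have hL : (d + 1 : ℤ) ∣ stepSum e false (e 0 + δ) - stepSum e false (e 0) := by
    obtain ⟨w, hw1, hw2⟩ := ((frequently_translate_left hθ x (e 0)).and_eventually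
      (eventually_stepSum_sub_eq (e := e) δ (e 0) s t false _ rfl)).exists
    rw [← hw2]
    exact hdvd w hw1
  have hR : (d + 1 : ℤ) ∣ stepSum e true (e 0 + δ) - stepSum e true (e 0) := by
    obtain ⟨w, hw1, hw2⟩ := ((frequently_translate_right hθ x (e 0)).and_eventually
      (eventually_stepSum_sub_eq (e := e) δ (e 0) s t true _ rfl)).exists
    rw [← hw2]
    exact hdvd w hw1
  have h1 := stepSum_false_add_one_le_true (e := e) 0
  have h2 := stepSum_true_le_false_add_one he (e 0)
  have h3 := stepSum_le_of_lt e (show e 0 < e 0 + δ by linarith) true false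
  have h4 := stepSum_le_of_lt e (show e 0 + δ < e 0 + 1 by linarith) true false
  have h5 := stepSum_false_le_true e (e 0 + δ)
  rw [stepSum_add_one] at h4
  have h6 := Int.le_of_dvd (by omega) hL
  have h7 := Int.le_of_dvd (by omega) hR
  omega

lemma codeLift_congr (hd : d ≠ 0) (he : ∀ i j, ∀ m : ℤ, e i - e j = m → i = j)
    (hθ : Dense {w | ∃ n : I, ∃ m : ℤ, w = θ n + m}) {P Q : I → ℤ}
    (hP : P ∈ liftSet e θ) (hQ : Q ∈ liftSet e θ)
    (h : ∀ n, (d + 1 : ℤ) ∣ Q n - P n) : ∃ m : ℤ, Q = P + fun _ => m * (d + 1) := by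
  obtain ⟨s, x, rfl⟩ := hP
  obtain ⟨t, y, rfl⟩ := hQ
  obtain ⟨m, w, rfl, hw0, hw1⟩ : ∃ (m : ℤ) (w : ℝ), y = w + m ∧ x ≤ w ∧ w < x + 1 :=
    ⟨⌊y - x⌋, y - ⌊y - x⌋, by ring, by linarith [Int.floor_le (y - x)],
      by linarith [Int.lt_floor_add_one (y - x)]⟩
  have h' : ∀ n, (d + 1 : ℤ) ∣ codeLift e θ t w n - codeLift e θ s x n := by
    intro n
    have h1 := h n
    rw [codeLift_add_int, Pi.add_apply, add_sub_right_comm] at h1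
    exact (Int.dvd_add_left (dvd_mul_left _ _)).1 h1
  refine ⟨m, ?_⟩
  rw [codeLift_add_int]
  congr 1
  rcases hw0.eq_or_lt with rfl | hlt
  · funext n
    have h1 := h' n
    have h2 := stepSum_true_le_false_add_one he (x + θ n)
    have h3 := stepSum_false_le_true e (x + θ n)
    have h4 : |codeLift e θ t x n - codeLift e θ s x n| < d + 1 := by
      rw [abs_lt]
      simp only [codeLift]
      cases s <;> cases t <;> constructor <;> omega
    have := Int.eq_zero_of_abs_lt_dvd h1 h4
    omega
  · exact absurd h' (not_codeLift_congr hd he hθ s t hlt hw1)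

end CodeLift

section IntervalTopology

namespace CircularOrderRel

variable {X : Type*} (R : CircularOrderRel X)

lemma ne_left {a b c : X} (h : R.rel a b c) : a ≠ b := by
  rintro rfl
  exact R.asymm _ _ _ h (R.cyclic _ _ _ h)

lemma ne_right {a b c : X} (h : R.rel a b c) : b ≠ c :=
  R.ne_left (R.cyclic _ _ _ h)

lemma ne_outer {a b c : X} (h : R.rel a b c) : a ≠ c :=
  (R.ne_left (R.cyclic _ _ _ (R.cyclic _ _ _ h))).symm

lemma isOpen_interval {a b : X} (h : a ≠ b) :
    IsOpen[intervalTopology R.rel] {x | R.rel a x b} :=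
  TopologicalSpace.isOpen_generateFrom_of_mem ⟨a, b, h, rfl⟩

lemma isCOP_of_injective {f : X → X} (hf : Function.Injective f)
    (h : ∀ a b c, R.rel a b c → R.rel (f a) (f b) (f c)) : IsCOP R.rel R.rel f := by
  refine ⟨fun a b c habc _ _ _ => h a b c habc, fun a c hac => Or.inl fun x hx => ?_⟩
  obtain rfl := hf hac
  rcases hx with (rfl | rfl) | hx
  · rfl
  · rfl
  · exact absurd rfl (R.ne_outer hx)

lemma separated_of_gap {a b u v : X} (hgap : ∀ x, ¬ R.rel a x b)
    (hab : a ≠ b) (hu : R.rel b u a) (hv : R.rel b v a) (huv : R.rel b u v) :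
    ∃ U V : Set X, IsOpen[intervalTopology R.rel] U ∧ IsOpen[intervalTopology R.rel] V ∧
      a ∈ U ∧ b ∈ V ∧ Disjoint U V := by
  refine ⟨{x | R.rel v x b}, {x | R.rel a x u}, R.isOpen_interval (R.ne_left hv).symm,
    R.isOpen_interval (R.ne_right hu).symm, R.cyclic _ _ _ hv,
    R.cyclic _ _ _ (R.cyclic _ _ _ hu), Set.disjoint_left.2 fun x hx1 hx2 => ?_⟩
  have hxb : x ≠ b := R.ne_right hx1
  have hax : a ≠ x := R.ne_left hx2
  have h1 : R.rel b x a := by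
    rcases R.total a x b hax hxb hab with h | h
    · exact absurd h (hgap x)
    · exact R.cyclic _ _ _ h
  have h2 : R.rel b u x := R.trans _ _ _ _ huv (R.cyclic _ _ _ (R.cyclic _ _ _ hx1))
  have h3 : R.rel x a u := R.trans _ _ _ _ (R.cyclic _ _ _ h1)
    (R.cyclic _ _ _ (R.cyclic _ _ _ h2))
  exact R.asymm _ _ _ h3 (R.cyclic _ _ _ hx2)

lemma separated_of_gap' [Infinite X] {a b : X} (hgap : ∀ x, ¬ R.rel a x b) (hab : a ≠ b) :
    ∃ U V : Set X, IsOpen[intervalTopology R.rel] U ∧ IsOpen[intervalTopology R.rel] V ∧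
      a ∈ U ∧ b ∈ V ∧ Disjoint U V := by
  classical
  obtain ⟨u, hu⟩ := Infinite.exists_notMem_finset ({a, b} : Finset X)
  obtain ⟨v, hv⟩ := Infinite.exists_notMem_finset ({a, b, u} : Finset X)
  simp only [Finset.mem_insert, Finset.mem_singleton, not_or] at hu hv
  have key : ∀ x, x ≠ a → x ≠ b → R.rel b x a := fun x h1 h2 => by
    rcases R.total a x b h1.symm h2 hab with h | h
    · exact absurd h (hgap x)
    · exact R.cyclic _ _ _ h
  have hu' := key u hu.1 hu.2
  have hv' := key v hv.1 hv.2.1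
  rcases R.total b u v (Ne.symm hu.2) (Ne.symm hv.2.2) (Ne.symm hv.2.1) with h | h
  · exact R.separated_of_gap hgap hab hu' hv' h
  · exact R.separated_of_gap hgap hab hv' hu' h

lemma t2Space_intervalTopology [Infinite X] : @T2Space X (intervalTopology R.rel) := by
  let _ := intervalTopology R.rel
  refine ⟨fun a b hab => ?_⟩
  by_cases h1 : ∃ u, R.rel a u b
  · by_cases h2 : ∃ v, R.rel b v a
    · obtain ⟨u, hu⟩ := h1
      obtain ⟨v, hv⟩ := h2
      have hauv : R.rel a u v := R.trans _ _ _ _ hu (R.cyclic _ _ _ (R.cyclic _ _ _ hv))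
      have hbvu : R.rel b v u := R.trans _ _ _ _ hv (R.cyclic _ _ _ (R.cyclic _ _ _ hu))
      refine ⟨{x | R.rel v x u}, {x | R.rel u x v}, R.isOpen_interval (R.ne_right hbvu),
        R.isOpen_interval (R.ne_right hauv), R.cyclic _ _ _ (R.cyclic _ _ _ hauv),
        R.cyclic _ _ _ (R.cyclic _ _ _ hbvu), Set.disjoint_left.2 fun x hx1 hx2 => ?_⟩
      exact R.asymm _ _ _ hx1 (R.cyclic _ _ _ (R.cyclic _ _ _ hx2))
    · push Not at h2
      obtain ⟨U, V, hU, hV, hbU, haV, hd⟩ := R.separated_of_gap' h2 hab.symm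
      exact ⟨V, U, hV, hU, haV, hbU, hd.symm⟩
  · push Not at h1
    exact R.separated_of_gap' h1 hab

lemma eq_intervalTopology [Infinite X] [t : TopologicalSpace X] [CompactSpace X]
    (h : ∀ a b, a ≠ b → IsOpen {x | R.rel a x b}) : t = intervalTopology R.rel := by
  have hle : t ≤ intervalTopology R.rel := by
    refine le_generateFrom ?_
    rintro _ ⟨a, b, hab, rfl⟩
    exact h a b hab
  refine le_antisymm hle fun s hs => ?_
  have hclosed := @Continuous.isClosedMap X X t (intervalTopology R.rel) _
    R.t2Space_intervalTopology id (continuous_id_iff_le.2 hle) sᶜ hs.isClosed_compl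
  rw [Set.image_id] at hclosed
  simpa using hclosed.isOpen_compl

end CircularOrderRel

end IntervalTopology

section LiftRel

variable {I Y : Type*}

/-- The circular relation on words induced by a chain `L` of integer-valued lifts that is
invariant under adding the constant `D`, where `p` reduces a lift to a word. -/
def liftRel (L : Set (I → ℤ)) (D : ℤ) (p : (I → ℤ) → Y) (a b c : Y) : Prop :=
  ∃ A ∈ L, ∃ B ∈ L, ∃ C ∈ L, p A = a ∧ p B = b ∧ p C = c ∧ A < B ∧ B < C ∧ C < A + fun _ => D

/-- A chain of lifts, invariant under adding multiples of `D`, whose reduction `p` identifies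
two lifts exactly when they differ by a multiple of `D`. -/
structure IsLiftChain (L : Set (I → ℤ)) (D : ℤ) (p : (I → ℤ) → Y) : Prop where
  pos : 0 < D
  chain : ∀ P ∈ L, ∀ Q ∈ L, P ≤ Q ∨ Q ≤ P
  add_mem : ∀ P ∈ L, ∀ m : ℤ, (P + fun _ => m * D) ∈ L
  map_add : ∀ P, ∀ m : ℤ, p (P + fun _ => m * D) = p P
  eq_add : ∀ P ∈ L, ∀ Q ∈ L, p P = p Q → ∃ m : ℤ, Q = P + fun _ => m * D

namespace IsLiftChain

variable {L : Set (I → ℤ)} {D : ℤ} {p : (I → ℤ) → Y}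

lemma add_one_mem (h : IsLiftChain L D p) {P : I → ℤ} (hP : P ∈ L) : (P + fun _ => D) ∈ L := by
  simpa using h.add_mem P hP 1

lemma map_add_one (h : IsLiftChain L D p) (P : I → ℤ) : p (P + fun _ => D) = p P := by
  simpa using h.map_add P 1

lemma unique (h : IsLiftChain L D p) [Nonempty I]
    {A P Q : I → ℤ} (hP : P ∈ L) (hQ : Q ∈ L) (hPQ : p P = p Q)
    (h1 : A < P) (h2 : P < A + fun _ => D) (h3 : A < Q) (h4 : Q < A + fun _ => D) : P = Q := by
  obtain ⟨m, rfl⟩ := h.eq_add P hP Q hQ hPQ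
  have hD := h.pos
  rcases lt_trichotomy m 0 with hm | rfl | hm
  · refine absurd (h3.trans_le fun i => ?_) (lt_irrefl _)
    have := h2.le i
    simp only [Pi.add_apply] at this ⊢
    nlinarith
  · funext i
    simp
  · refine absurd (h4.trans_le fun i => ?_) (lt_irrefl _)
    have := h1.le i
    simp only [Pi.add_apply] at this ⊢
    nlinarith

lemma exists_lift (h : IsLiftChain L D p) [Nonempty I]
    {A B : I → ℤ} (hA : A ∈ L) (hB : B ∈ L) (hAB : p A ≠ p B) :
    ∃ P ∈ L, p P = p B ∧ A < P ∧ P < A + fun _ => D := by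
  obtain ⟨i⟩ := ‹Nonempty I›
  have hD := h.pos
  obtain ⟨P, hP, hPB, h1, h2⟩ : ∃ P ∈ L, p P = p B ∧ A i ≤ P i ∧ P i < A i + D := by
    refine ⟨_, h.add_mem B hB (-((B i - A i) / D)), h.map_add _ _, ?_, ?_⟩
    · have := Int.emod_nonneg (B i - A i) hD.ne'
      rw [Int.emod_def] at this
      simp only [Pi.add_apply]
      linarith
    · have := Int.emod_lt_of_pos (B i - A i) hD
      rw [Int.emod_def] at this
      simp only [Pi.add_apply]
      linarith
  have hne : A ≠ P := fun h' => hAB (by rw [h', hPB])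
  rcases h.chain A hA P hP with hle | hle
  · refine ⟨P, hP, hPB, hle.lt_of_ne hne, lt_of_le_of_ne ?_ ?_⟩
    · rcases h.chain P hP _ (h.add_one_mem hA) with h' | h'
      · exact h'
      · exact absurd (h' i) (by simpa using h2)
    · intro h'
      exact hAB (by rw [← hPB, h', h.map_add_one])
  · refine ⟨_, h.add_one_mem hP, (h.map_add_one P).trans hPB, lt_of_le_of_ne ?_ ?_,
      add_lt_add_left (hle.lt_of_ne hne.symm) _⟩
    · rcases h.chain A hA _ (h.add_one_mem hP) with h' | h'
      · exact h'
      · refine absurd (h' i) ?_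
        simp only [Pi.add_apply]
        omega
    · intro h'
      exact hAB (by rw [← hPB, h', h.map_add_one])

lemma liftRel_lift (h : IsLiftChain L D p)
    {a b c : Y} (habc : liftRel L D p a b c) {A : I → ℤ} (hA : A ∈ L)
    (hAa : p A = a) : ∃ B ∈ L, ∃ C ∈ L, p B = b ∧ p C = c ∧ A < B ∧ B < C ∧
      C < A + fun _ => D := by
  obtain ⟨A', hA', B, hB, C, hC, rfl, rfl, rfl, h1, h2, h3⟩ := habc
  obtain ⟨m, rfl⟩ := h.eq_add A' hA' A hA hAa.symm
  refine ⟨_, h.add_mem B hB m, _, h.add_mem C hC m, h.map_add _ _, h.map_add _ _,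
    add_lt_add_left h1 _, add_lt_add_left h2 _, ?_⟩
  rw [add_right_comm]
  exact add_lt_add_left h3 _

lemma liftRel_cyclic (h : IsLiftChain L D p)
    {a b c : Y} (habc : liftRel L D p a b c) : liftRel L D p b c a := by
  obtain ⟨A, hA, B, hB, C, hC, rfl, rfl, rfl, h1, h2, h3⟩ := habc
  exact ⟨B, hB, C, hC, _, h.add_one_mem hA, rfl, rfl, h.map_add_one A, h2, h3,
    add_lt_add_left h1 _⟩

lemma liftRel_asymm (h : IsLiftChain L D p) [Nonempty I] {a b c : Y} (habc : liftRel L D p a b c) :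
    ¬ liftRel L D p a c b := by
  intro hacb
  obtain ⟨A, hA, B, hB, C, hC, rfl, rfl, rfl, h1, h2, h3⟩ := habc
  obtain ⟨C', hC', B', hB', h4, h5, h6, h7, h8⟩ := h.liftRel_lift hacb hA rfl
  have hBB := h.unique hB hB' h5.symm h1 (h2.trans h3) (h6.trans h7) h8
  have hCC := h.unique hC hC' h4.symm (h1.trans h2) h3 h6 (h7.trans h8)
  subst hBB hCC
  exact lt_irrefl _ (h2.trans h7)

lemma liftRel_trans (h : IsLiftChain L D p) [Nonempty I] {a b c e : Y} (habc : liftRel L D p a b c)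
    (hace : liftRel L D p a c e) : liftRel L D p a b e := by
  obtain ⟨A, hA, B, hB, C, hC, rfl, rfl, rfl, h1, h2, h3⟩ := habc
  obtain ⟨C', hC', E, hE, h4, h5, h6, h7, h8⟩ := h.liftRel_lift hace hA rfl
  have hCC := h.unique hC hC' h4.symm (h1.trans h2) h3 h6 (h7.trans h8)
  subst hCC
  exact ⟨A, hA, B, hB, E, hE, rfl, rfl, h5, h1, h2.trans h7, h8⟩

lemma liftRel_total (h : IsLiftChain L D p) [Nonempty I]
    {A B C : I → ℤ} (hA : A ∈ L) (hB : B ∈ L) (hC : C ∈ L)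
    (hAB : p A ≠ p B) (hBC : p B ≠ p C) (hAC : p A ≠ p C) :
    liftRel L D p (p A) (p B) (p C) ∨ liftRel L D p (p A) (p C) (p B) := by
  obtain ⟨B', hB', h1, h2, h3⟩ := h.exists_lift hA hB hAB
  obtain ⟨C', hC', h4, h5, h6⟩ := h.exists_lift hA hC hAC
  have hne : B' ≠ C' := fun h' => hBC (by rw [← h1, h', h4])
  rcases h.chain B' hB' C' hC' with h' | h'
  · exact Or.inl ⟨A, hA, B', hB', C', hC', rfl, h1, h4, h2, h'.lt_of_ne hne, h6⟩
  · exact Or.inr ⟨A, hA, C', hC', B', hB', rfl, h4, h1, h5, h'.lt_of_ne hne.symm, h3⟩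

/-- The circular order on a set of words all of which have lifts. -/
def circularOrder (h : IsLiftChain L D p) [Nonempty I]
    {X : Set Y} (hX : ∀ a ∈ X, ∃ A ∈ L, p A = a) :
    CircularOrderRel X where
  rel a b c := liftRel L D p a b c
  cyclic _ _ _ := h.liftRel_cyclic
  asymm _ _ _ := h.liftRel_asymm
  trans _ _ _ _ := h.liftRel_trans
  total := by
    rintro ⟨a, ha⟩ ⟨b, hb⟩ ⟨c, hc⟩ hab hbc hac
    obtain ⟨A, hA, rfl⟩ := hX a ha
    obtain ⟨B, hB, rfl⟩ := hX b hb
    obtain ⟨C, hC, rfl⟩ := hX c hc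
    exact h.liftRel_total hA hB hC (fun h' => hab (Subtype.ext h'))
      (fun h' => hbc (Subtype.ext h')) (fun h' => hac (Subtype.ext h'))

/-- The complement of an open interval consists of the words with a lift in a closed interval. -/
lemma not_liftRel_iff (h : IsLiftChain L D p) [Nonempty I]
    {A B : I → ℤ} (hA : A ∈ L) (hB : B ∈ L) (h1 : A < B)
    (h2 : B < A + fun _ => D) {x : Y} (hx : ∃ P ∈ L, p P = x) :
    ¬ liftRel L D p (p A) x (p B) ↔ ∃ P ∈ L ∩ Set.Icc B (A + fun _ => D), p P = x := by
  constructor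
  · intro hn
    obtain ⟨P, hP, rfl⟩ := hx
    by_cases hAP : p A = p P
    · exact ⟨_, ⟨h.add_one_mem hA, h2.le, le_rfl⟩, (h.map_add_one A).trans hAP⟩
    · obtain ⟨Q, hQ, h3, h4, h5⟩ := h.exists_lift hA hP hAP
      refine ⟨Q, ⟨hQ, ?_, h5.le⟩, h3⟩
      rcases h.chain B hB Q hQ with h' | h'
      · exact h'
      · by_cases hQB : Q = B
        · exact hQB.ge
        · exact absurd ⟨A, hA, Q, hQ, B, hB, rfl, h3, rfl, h4, h'.lt_of_ne hQB, h2⟩ hn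
  · rintro ⟨P, ⟨hP, h3, h4⟩, rfl⟩ hr
    obtain ⟨Q, hQ, B', hB', h5, h6, h7, h8, h9⟩ := h.liftRel_lift hr hA rfl
    have := h.unique hB hB' h6.symm h1 h2 (h7.trans h8) h9
    subst this
    rcases h4.eq_or_lt with rfl | hlt
    · rw [h.map_add_one] at h5
      obtain ⟨m, rfl⟩ := h.eq_add A hA Q hQ h5.symm
      obtain ⟨i⟩ := ‹Nonempty I›
      have hD := h.pos
      rcases le_or_gt m 0 with hm | hm
      · refine lt_irrefl _ (h7.trans_le fun j => ?_)
        simp only [Pi.add_apply]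
        nlinarith
      · refine lt_irrefl _ ((h8.trans h9).trans_le fun j => ?_)
        simp only [Pi.add_apply]
        nlinarith
    · have := h.unique hP hQ h5.symm (h1.trans_le h3) hlt h7 (h8.trans h9)
      subst this
      exact lt_irrefl _ (h8.trans_le h3)

end IsLiftChain

end LiftRel

section Circle

lemma circleRep_coe (x : ℝ) : circleRep (x : AddCircle (1 : ℝ)) = Int.fract x := by
  have : Fact ((0 : ℝ) < 1) := ⟨one_pos⟩
  have h := AddCircle.coe_equivIco_mk_apply (1 : ℝ) x
  rw [div_one, mul_one] at h
  exact h

lemma coe_circleRep (x : AddCircle (1 : ℝ)) : (circleRep x : AddCircle (1 : ℝ)) = x := by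
  induction x using QuotientAddGroup.induction_on with
  | H x => exact (congrArg _ (circleRep_coe x)).trans (AddCircle.coe_fract x)

lemma fract_sub_eq (a b : ℝ) : Int.fract (b - a) =
    if Int.fract a ≤ Int.fract b then Int.fract b - Int.fract a
    else Int.fract b - Int.fract a + 1 := by
  have ha0 := Int.fract_nonneg a
  have ha1 := Int.fract_lt_one a
  have hb0 := Int.fract_nonneg b
  have hb1 := Int.fract_lt_one b
  have hab : b - a = Int.fract b - Int.fract a + (⌊b⌋ - ⌊a⌋ : ℤ) := by
    push_cast
    simp only [Int.fract]
    ring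
  rw [hab, Int.fract_add_intCast]
  split_ifs with h
  · exact Int.fract_eq_self.2 ⟨by linarith, by linarith⟩
  · rw [← Int.fract_add_one]
    exact Int.fract_eq_self.2 ⟨by linarith, by linarith⟩

lemma stdCircRel_coe_iff (a b c : ℝ) :
    stdCircRel (a : AddCircle (1 : ℝ)) b c ↔
      0 < Int.fract (b - a) ∧ Int.fract (b - a) < Int.fract (c - a) := by
  rw [stdCircRel, circleRep_coe, circleRep_coe, circleRep_coe, fract_sub_eq, fract_sub_eq]
  have ha0 := Int.fract_nonneg a
  have ha1 := Int.fract_lt_one a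
  have hb0 := Int.fract_nonneg b
  have hb1 := Int.fract_lt_one b
  have hc0 := Int.fract_nonneg c
  have hc1 := Int.fract_lt_one c
  simp only [mul_pos_iff, mul_neg_iff, sub_pos, sub_neg]
  grind

end Circle

section Coloring

variable {d : ℕ}

/-- The position of the `i`-th endpoint, measured from the `0`-th one. -/
noncomputable def arcOffset (c : Fin (d + 1) → AddCircle (1 : ℝ)) (i : Fin (d + 1)) : ℝ :=
  Int.fract (circleRep (c i) - circleRep (c 0))

/-- The color of the arc reached after `m` steps from the left of the `0`-th endpoint. -/
def stepColor {Δ : Type*} (F : Fin (d + 1) → Δ) (m : ℤ) : Δ :=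
  F ⟨((m + d) % (d + 1)).toNat, by
    have h1 := Int.emod_nonneg (m + d) (show (d + 1 : ℤ) ≠ 0 by omega)
    have h2 := Int.emod_lt_of_pos (m + d) (show (0 : ℤ) < d + 1 by omega)
    omega⟩

lemma stepColor_eq_iff {Δ : Type*} {F : Fin (d + 1) → Δ} (hF : Function.Injective F) (m l : ℤ) :
    stepColor F m = stepColor F l ↔ (d + 1 : ℤ) ∣ l - m := by
  have h1 := Int.emod_nonneg (m + d) (show (d + 1 : ℤ) ≠ 0 by omega)
  have h2 := Int.emod_nonneg (l + d) (show (d + 1 : ℤ) ≠ 0 by omega)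
  rw [stepColor, stepColor, hF.eq_iff, Fin.mk.injEq, show l - m = (l + d) - (m + d) by ring,
    ← Int.modEq_iff_dvd, Int.ModEq]
  omega

lemma stepColor_add_mul {Δ : Type*} (F : Fin (d + 1) → Δ) (m l : ℤ) :
    stepColor F (m + l * (d + 1)) = stepColor F m := by
  simp only [stepColor, add_right_comm m, Int.add_mul_emod_self_right]

variable {c : Fin (d + 1) → AddCircle (1 : ℝ)}

lemma arcOffset_zero : arcOffset c 0 = 0 := by simp [arcOffset]

lemma coe_add_arcOffset (i : Fin (d + 1)) :
    ((circleRep (c 0) + arcOffset c i : ℝ) : AddCircle (1 : ℝ)) = c i := by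
  rw [arcOffset, AddCircle.coe_add, AddCircle.coe_fract, ← AddCircle.coe_add, add_sub_cancel,
    coe_circleRep]

lemma arcOffset_eq_of_sub_int (hc : Function.Injective c) (i j : Fin (d + 1)) (m : ℤ)
    (h : arcOffset c i - arcOffset c j = m) : i = j := by
  refine hc ?_
  rw [← coe_add_arcOffset (c := c) i, ← coe_add_arcOffset (c := c) j,
    show circleRep (c 0) + arcOffset c i = circleRep (c 0) + arcOffset c j + m by linarith,
    AddCircle.coe_add (x := _ + _), add_eq_left, AddCircle.coe_eq_zero_iff]
  exact ⟨m, by simp⟩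

lemma arcOffset_strictMono (hc : Function.Injective c)
    (hcyc : ∀ i j l : Fin (d + 1), cyclicFin i j l → stdCircRel (c i) (c j) (c l)) :
    StrictMono (arcOffset c) := by
  intro i j hij
  rcases eq_or_ne i 0 with rfl | hi
  · rw [arcOffset_zero]
    refine lt_of_le_of_ne (Int.fract_nonneg _) fun h => hij.ne' ?_
    exact arcOffset_eq_of_sub_int hc j 0 0 (by rw [arcOffset_zero, ← h]; simp)
  · have h := hcyc 0 i j (Or.inl ⟨Fin.pos_of_ne_zero hi, hij⟩)
    rw [← coe_circleRep (c 0), ← coe_circleRep (c i), ← coe_circleRep (c j),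
      stdCircRel_coe_iff] at h
    exact h.2

lemma stepSum_arcOffset_eq {t : ℝ} (ht0 : 0 ≤ t) (ht1 : t < 1) (j : Fin (d + 1))
    (h1 : ∀ i ≤ j, arcOffset c i ≤ t) (h2 : ∀ i, j < i → t < arcOffset c i) :
    stepSum (arcOffset c) true t + d = j := by
  have h : ∀ i, sidedFloor true (t - arcOffset c i) = if j < i then -1 else 0 := by
    intro i
    have h3 : 0 ≤ arcOffset c i := Int.fract_nonneg _
    have h4 : arcOffset c i < 1 := Int.fract_lt_one _
    simp only [sidedFloor, if_true]
    split_ifs with hij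
    · have := h2 i hij
      rw [Int.floor_eq_iff]
      constructor <;> push_cast <;> linarith
    · have := h1 i (not_lt.1 hij)
      rw [Int.floor_eq_iff]
      constructor <;> push_cast <;> linarith
  rw [stepSum, Finset.sum_congr rfl fun i _ => h i, ← Finset.sum_filter, Finset.sum_const,
    Finset.filter_lt_eq_Ioi, Fin.card_Ioi]
  have := j.2
  simp only [nsmul_eq_mul]
  omega

lemma color_eq_stepColor (hc : Function.Injective c)
    (hcyc : ∀ i j l : Fin (d + 1), cyclicFin i j l → stdCircRel (c i) (c j) (c l))
    {f : AddCircle (1 : ℝ) → Fin (d + 1)}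
    (hf : ∀ i : Fin (d + 1), ∀ x ∈ circleArc (c i) (c (i + 1)), f x = f (c i)) (t : ℝ) :
    f ((circleRep (c 0) + t : ℝ) : AddCircle (1 : ℝ)) =
      stepColor (fun i => f (c i)) (stepSum (arcOffset c) true t) := by
  rcases Nat.eq_zero_or_pos d with rfl | hd
  · exact Fin.ext (by omega)
  wlog ht : 0 ≤ t ∧ t < 1 generalizing t
  · have h := this (Int.fract t) ⟨Int.fract_nonneg _, Int.fract_lt_one _⟩
    have h' : stepSum (arcOffset c) true t =
        stepSum (arcOffset c) true (Int.fract t) + ⌊t⌋ * (d + 1) := by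
      rw [← stepSum_add_int, Int.fract_add_floor]
    rw [h', stepColor_add_mul, ← h, AddCircle.coe_add, AddCircle.coe_add, AddCircle.coe_fract]
  obtain ⟨ht0, ht1⟩ := ht
  have hmono := arcOffset_strictMono hc hcyc
  obtain ⟨j, hjt, hjmax⟩ : ∃ j, arcOffset c j ≤ t ∧ ∀ i, j < i → t < arcOffset c i := by
    have hne : (Finset.univ.filter fun i => arcOffset c i ≤ t).Nonempty :=
      ⟨0, by simpa [arcOffset_zero] using ht0⟩
    refine ⟨Finset.max' _ hne, (Finset.mem_filter.1 (Finset.max'_mem _ hne)).2, fun i hi => ?_⟩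
    by_contra! hle
    exact absurd (Finset.le_max' _ i (by simpa using hle)) (not_le.2 hi)
  have hstep := stepSum_arcOffset_eq ht0 ht1 j
    (fun i hi => (hmono.monotone hi).trans hjt) hjmax
  have hcol : stepColor (fun i => f (c i)) (stepSum (arcOffset c) true t) = f (c j) := by
    rw [stepColor]
    congr 2
    rw [Fin.ext_iff]
    have : ((j : ℕ) : ℤ) % (d + 1) = j := Int.emod_eq_of_lt (by omega) (by omega)
    simp only [hstep, this, Int.toNat_natCast]
  rw [hcol]
  refine hf j _ ?_
  rcases hjt.eq_or_lt with heq | hlt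
  · left
    rw [← heq, coe_add_arcOffset]
  · right
    change stdCircRel _ _ _
    rw [← coe_add_arcOffset (c := c) j, ← coe_add_arcOffset (c := c) (j + 1), stdCircRel_coe_iff,
      add_sub_add_left_eq_sub, add_sub_add_left_eq_sub]
    have hj0 : 0 ≤ arcOffset c j := Int.fract_nonneg _
    have h1 : Int.fract (t - arcOffset c j) = t - arcOffset c j :=
      Int.fract_eq_self.2 ⟨by linarith, by linarith⟩
    rw [h1]
    refine ⟨by linarith, ?_⟩
    rcases eq_or_ne j (Fin.last d) with rfl | hjd
    · have hpos : 0 < arcOffset c (Fin.last d) := by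
        rw [← arcOffset_zero (c := c)]
        refine hmono (Fin.lt_def.2 ?_)
        simpa using hd
      rw [Fin.last_add_one, arcOffset_zero, ← Int.fract_add_one,
        Int.fract_eq_self.2 ⟨by linarith, by linarith⟩]
      linarith
    · have hjlt : j < j + 1 := Fin.lt_add_one_iff.2 (Fin.lt_last_iff_ne_last.2 hjd)
      have h2 := hjmax _ hjlt
      have h3 : arcOffset c (j + 1) < 1 := Int.fract_lt_one _
      rw [Int.fract_eq_self.2 ⟨by linarith, by linarith⟩]
      linarith

end Coloring

section Tame

variable {I Δ : Type*} [TopologicalSpace Δ] [DiscreteTopology Δ]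

lemma exists_finset_forall_abs_sub_lt {X : Set (I → Δ)} (hX : IsCompact X) {F : X → ℝ}
    (hF : Continuous F) {ε : ℝ} (hε : 0 < ε) :
    ∃ W : Finset I, ∀ x y : X, (∀ n ∈ W, x.1 n = y.1 n) → |F x - F y| < ε := by
  classical
  have : CompactSpace X := isCompact_iff_compactSpace.1 hX
  have hloc : ∀ x : X, ∃ W : Finset I, ∀ y : X, (∀ n ∈ W, y.1 n = x.1 n) →
      |F y - F x| < ε / 2 := by
    intro x
    have hopen : IsOpen {y : X | |F y - F x| < ε / 2} :=
      isOpen_lt (hF.sub continuous_const).abs continuous_const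
    obtain ⟨V, hV, hVeq⟩ := isOpen_induced_iff.1 hopen
    have hxV : x ∈ Subtype.val ⁻¹' V := by
      rw [hVeq]
      simpa using half_pos hε
    obtain ⟨W, u, hu, hsub⟩ := isOpen_pi_iff.1 hV x.1 hxV
    refine ⟨W, fun y hy => ?_⟩
    have : y ∈ Subtype.val ⁻¹' V := hsub fun n hn => by
      rw [hy n hn]
      exact (hu n hn).2
    rwa [hVeq] at this
  choose W hW using hloc
  obtain ⟨t, ht⟩ := isCompact_univ.elim_finite_subcover
    (fun x : X => {y : X | ∀ n ∈ W x, y.1 n = x.1 n})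
    (fun x => by
      have heq : {y : X | ∀ n ∈ W x, y.1 n = x.1 n} =
          ⋂ n ∈ W x, (fun y : X => y.1 n) ⁻¹' {x.1 n} := by
        ext y
        simp
      rw [heq]
      exact isOpen_biInter_finset fun n _ => (isOpen_discrete _).preimage
        ((continuous_apply n).comp continuous_subtype_val))
    (fun x _ => Set.mem_iUnion.2 ⟨x, fun _ _ => rfl⟩)
  refine ⟨t.biUnion W, fun x y hxy => ?_⟩
  obtain ⟨w, hwt, hxw⟩ := Set.mem_iUnion₂.1 (ht (Set.mem_univ x))
  have h1 := hW w x hxw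
  have h2 := hW w y fun n hn => by
    rw [← hxy n (Finset.mem_biUnion.2 ⟨w, hwt, hn⟩)]
    exact hxw n hn
  rw [abs_lt] at *
  constructor <;> linarith

lemma exists_mul_add_one_lt_two_pow (C : ℕ) : ∃ N : ℕ, N * C + 1 < 2 ^ N := by
  have h := tendsto_pow_const_div_const_pow_of_one_lt 1 (show (1 : ℝ) < 2 by norm_num)
  have hpos : (0 : ℝ) < 1 / (C + 1) := by positivity
  obtain ⟨N, hN, hN1⟩ := ((h.eventually_lt_const hpos).and (eventually_ge_atTop 1)).exists
  refine ⟨N, ?_⟩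
  rw [pow_one, div_lt_div_iff₀ (by positivity) (by positivity), one_mul] at hN
  have : N * (C + 1) < 2 ^ N := by exact_mod_cast hN
  nlinarith

/-- A subshift whose words have lifts in a chain of bounded width has at most linear complexity,
hence no independent sequences. -/
lemma not_isIndepSeq_of_lift [AddGroup I] {X : Set (I → Δ)} (hX : IsCompact X)
    {q : ℤ → Δ} {L : Set (I → ℤ)} (hL : ∀ P ∈ L, ∀ Q ∈ L, P ≤ Q ∨ Q ≤ P) (B : I → ℤ) (D : ℕ)
    (hlift : ∀ ω ∈ X, ∃ P ∈ L, (fun n => q (P n)) = ω ∧ B ≤ P ∧ P ≤ B + fun _ => (D : ℤ))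
    (S : I → X → X) (hS : ∀ g ω t, (S g ω).1 t = ω.1 (t + g))
    {F : X → ℝ} (hF : Continuous F) (g : ℕ → I) :
    ¬ IsIndepSeq (fun n ω => F (S (g n) ω)) := by
  classical
  rintro ⟨a, b, hab, hind⟩
  obtain ⟨W, hW⟩ := exists_finset_forall_abs_sub_lt hX hF (sub_pos.2 hab)
  obtain ⟨N, hN⟩ := exists_mul_add_one_lt_two_pow (W.card * D)
  set T : Finset I := (Finset.range N ×ˢ W).image fun r => r.2 + g r.1 with hT
  have hTcard : T.card ≤ N * W.card := by
    refine Finset.card_image_le.trans ?_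
    simp
  have hex : ∀ P : Finset ℕ, ∃ ω : X, (∀ n ∈ P, F (S (g n) ω) < a) ∧
      ∀ n ∈ Finset.range N \ P, b < F (S (g n) ω) := by
    intro P
    obtain ⟨ω, h1, h2⟩ := hind P (Finset.range N \ P) Finset.disjoint_sdiff
    exact ⟨ω, by simpa using h1, by simpa using h2⟩
  choose ω hω1 hω2 using hex
  choose! ℓ hℓL hℓω hℓ1 hℓ2 using hlift
  set Z : ℤ := ∑ n ∈ T, B n with hZ
  have hmaps : ∀ P ∈ (Finset.range N).powerset,
      ∑ n ∈ T, ℓ (ω P) n ∈ Finset.Icc Z (Z + T.card * D) := by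
    intro P _
    rw [Finset.mem_Icc]
    refine ⟨Finset.sum_le_sum fun n _ => hℓ1 _ (ω P).2 n, ?_⟩
    have h1 : ∑ n ∈ T, ℓ (ω P) n ≤ ∑ n ∈ T, (B n + (D : ℤ)) :=
      Finset.sum_le_sum fun n _ => hℓ2 _ (ω P).2 n
    simpa [Finset.sum_add_distrib] using h1
  have hsum : ∀ P Q : Finset ℕ, ∑ n ∈ T, ℓ (ω P) n = ∑ n ∈ T, ℓ (ω Q) n →
      ∀ n ∈ T, ℓ (ω P) n = ℓ (ω Q) n := by
    intro P Q h
    rcases hL _ (hℓL _ (ω P).2) _ (hℓL _ (ω Q).2) with h' | h'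
    · exact (Finset.sum_eq_sum_iff_of_le fun n _ => h' n).1 h
    · exact fun n hn => ((Finset.sum_eq_sum_iff_of_le fun n _ => h' n).1 h.symm n hn).symm
  have hsub : ∀ P ∈ (Finset.range N).powerset, ∀ Q : Finset ℕ,
      ∑ n ∈ T, ℓ (ω P) n = ∑ n ∈ T, ℓ (ω Q) n → P ⊆ Q := by
    intro P hP Q h n hnP
    by_contra hnQ
    have hnN := Finset.mem_powerset.1 hP hnP
    have h1 := hω1 P n hnP
    have h2 := hω2 Q n (Finset.mem_sdiff.2 ⟨hnN, hnQ⟩)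
    have h3 := hW (S (g n) (ω P)) (S (g n) (ω Q)) fun t ht => by
      rw [hS, hS, ← hℓω _ (ω P).2, ← hℓω _ (ω Q).2]
      simp only
      rw [hsum P Q h _ (Finset.mem_image.2 ⟨(n, t), Finset.mem_product.2 ⟨hnN, ht⟩, rfl⟩)]
    rw [abs_lt] at h3
    linarith [h3.1]
  have hcard := Finset.card_le_card_of_injOn (fun P => ∑ n ∈ T, ℓ (ω P) n) hmaps
    fun P hP Q hQ h => (hsub P hP Q h).antisymm (hsub Q hQ P h.symm)
  rw [Finset.card_powerset, Finset.card_range, Int.card_Icc] at hcard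
  have h1 : T.card * D ≤ N * (W.card * D) := by
    rw [← mul_assoc]
    exact Nat.mul_le_mul_right _ hTcard
  have h2 : (Z + T.card * D + 1 - Z).toNat = T.card * D + 1 := by
    rw [show Z + T.card * D + 1 - Z = ((T.card * D + 1 : ℕ) : ℤ) by push_cast; ring]
    exact Int.toNat_natCast _
  omega

end Tame

section Subshift

variable {d k : ℕ} {Δ : Type*}

/-- Translation of an angle by the integer combinations of the `α j`. -/
def angleHom (α : Fin k → ℝ) : (Fin k → ℤ) →+ ℝ :=
  AddMonoidHom.mk' (fun n => ∑ j, n j * α j) fun m n => by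
    simp [add_mul, Finset.sum_add_distrib]

lemma dense_angleHom {α : Fin k → ℝ} (hα : ∃ j, Irrational (α j)) :
    Dense {w | ∃ n : Fin k → ℤ, ∃ m : ℤ, w = angleHom α n + m} := by
  obtain ⟨j, hj⟩ := hα
  have h : Dense (AddSubgroup.closure {α j, 1} : Set ℝ) :=
    dense_addSubgroupClosure_pair_iff.2 (by simpa using hj)
  refine h.mono fun w hw => ?_
  obtain ⟨l, m, rfl⟩ := AddSubgroup.mem_closure_pair.1 hw
  refine ⟨Pi.single j l, m, ?_⟩
  simp [angleHom, Pi.single_apply, ite_mul]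

/-- The word obtained by reducing a lift to colors. -/
def colorWord {I : Type*} (F : Fin (d + 1) → Δ) (P : I → ℤ) : I → Δ :=
  fun n => stepColor F (P n)

lemma continuous_colorWord {I : Type*} [TopologicalSpace Δ] (F : Fin (d + 1) → Δ) :
    Continuous (colorWord F : (I → ℤ) → I → Δ) :=
  continuous_pi fun n => continuous_of_discreteTopology.comp (continuous_apply n)

lemma colorWord_add {I : Type*} (F : Fin (d + 1) → Δ) (P : I → ℤ) (m : ℤ) :
    colorWord F (P + fun _ => m * ((d : ℤ) + 1)) = colorWord F P :=
  funext fun n => stepColor_add_mul F (P n) m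

variable (e : Fin (d + 1) → ℝ) (θ : (Fin k → ℤ) →+ ℝ) (F : Fin (d + 1) → Δ)

lemma exists_codeLift_unit {ω : (Fin k → ℤ) → Δ} (hω : ω ∈ colorWord F '' liftSet e θ) :
    ∃ s x, 0 ≤ x ∧ x < 1 ∧ colorWord F (codeLift e θ s x) = ω := by
  obtain ⟨_, ⟨s, x, rfl⟩, rfl⟩ := hω
  refine ⟨s, Int.fract x, Int.fract_nonneg x, Int.fract_lt_one x, ?_⟩
  rw [← colorWord_add F _ ⌊x⌋, ← codeLift_add_int, Int.fract_add_floor]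

lemma shiftZk_colorWord (s : Bool) (x : ℝ) (g : Fin k → ℤ) :
    shiftZk g (colorWord F (codeLift e θ s x)) = colorWord F (codeLift e θ s (x + θ g)) :=
  funext fun n => congrArg (stepColor F) (codeLift_add_apply e θ s x g n)

variable {e θ F}

lemma isLiftChain_liftSet (hd : d ≠ 0) (he : ∀ i j, ∀ m : ℤ, e i - e j = m → i = j)
    (hθ : Dense {w | ∃ n, ∃ m : ℤ, w = θ n + m}) (hF : Function.Injective F) :
    IsLiftChain (liftSet e θ) (d + 1) (colorWord F) where
  pos := by omega
  chain _ hP _ hQ := liftSet_chain e θ hP hQ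
  add_mem _ hP m := liftSet_add e θ hP m
  map_add := colorWord_add F
  eq_add _ hP _ hQ h := codeLift_congr hd he hθ hP hQ fun n =>
    (stepColor_eq_iff hF _ _).1 (congrFun h n)

lemma infinite_colorWord_liftSet (hd : d ≠ 0) (he : ∀ i j, ∀ m : ℤ, e i - e j = m → i = j)
    (hθ : Dense {w | ∃ n, ∃ m : ℤ, w = θ n + m}) (hF : Function.Injective F) :
    Infinite (colorWord F '' liftSet e θ) := by
  have hlt : ∀ x y : Set.Ico (0 : ℝ) 1, x < y →
      colorWord F (codeLift e θ true x) ≠ colorWord F (codeLift e θ true y) := by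
    intro x y hxy h
    have h1 := x.2.1
    have h2 := y.2.2
    exact not_codeLift_congr hd he hθ true true hxy (by linarith) fun n =>
      (stepColor_eq_iff hF _ _).1 (congrFun h n)
  have : Infinite (Set.Ico (0 : ℝ) 1) := (Set.Ico_infinite one_pos).to_subtype
  refine Infinite.of_injective (fun x : Set.Ico (0 : ℝ) 1 =>
    (⟨colorWord F (codeLift e θ true x), _, codeLift_mem_liftSet e θ true x, rfl⟩ :
      colorWord F '' liftSet e θ)) fun x y hxy => ?_
  have hxy' := congrArg Subtype.val hxy
  rcases lt_trichotomy x y with h | h | h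
  · exact absurd hxy' (hlt x y h)
  · exact h
  · exact absurd hxy'.symm (hlt y x h)

variable (e θ F)

variable [TopologicalSpace Δ]

lemma isCompact_colorWord_liftSet : IsCompact (colorWord F '' liftSet e θ) := by
  have heq : colorWord F '' liftSet e θ = colorWord F ''
      ((fun r : Bool × ℝ => codeLift e θ r.1 r.2) '' (Set.univ ×ˢ Set.Icc 0 1)) := by
    refine Set.Subset.antisymm (fun ω hω => ?_) (Set.image_mono ?_)
    · obtain ⟨s, x, h0, h1, rfl⟩ := exists_codeLift_unit e θ F hω
      exact ⟨_, ⟨(s, x), ⟨Set.mem_univ _, h0, h1.le⟩, rfl⟩, rfl⟩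
    · rintro _ ⟨⟨s, x⟩, -, rfl⟩
      exact codeLift_mem_liftSet e θ s x
  rw [heq]
  exact (isCompact_codeLift_Icc e θ 0 1).image (continuous_colorWord F)

variable [T2Space Δ] {e θ}

/-- Every one-sided coding has the same orbit closure, the set of all one-sided codings. -/
lemma closure_orbit_colorWord (hθ : Dense {w | ∃ n, ∃ m : ℤ, w = θ n + m}) (s : Bool) (x : ℝ) :
    closure {ω | ∃ g : Fin k → ℤ, ω = shiftZk g (colorWord F (codeLift e θ s x))} =
      colorWord F '' liftSet e θ := by
  refine Set.Subset.antisymm (closure_minimal ?_ (isCompact_colorWord_liftSet e θ F).isClosed) ?_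
  · rintro _ ⟨g, rfl⟩
    exact ⟨_, codeLift_mem_liftSet e θ s (x + θ g), (shiftZk_colorWord e θ F s x g).symm⟩
  · have hmem : ∀ w, (∃ n, ∃ m : ℤ, w = x + θ n + m) → colorWord F (codeLift e θ s w) ∈
        {ω | ∃ g : Fin k → ℤ, ω = shiftZk g (colorWord F (codeLift e θ s x))} := by
      rintro _ ⟨n, m, rfl⟩
      exact ⟨n, by rw [codeLift_add_int, colorWord_add, shiftZk_colorWord]⟩
    rintro _ ⟨_, ⟨t, y, rfl⟩, rfl⟩
    cases t
    · exact mem_closure_of_frequently_of_tendsto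
        ((frequently_translate_left hθ x y).mono hmem)
        (((continuous_colorWord F).tendsto _).comp (tendsto_codeLift_left e θ y fun _ => s))
    · exact mem_closure_of_frequently_of_tendsto
        ((frequently_translate_right hθ x y).mono hmem)
        (((continuous_colorWord F).tendsto _).comp (tendsto_codeLift_right e θ y fun _ => s))

variable {F}

lemma exists_circularOrder (hd : d ≠ 0) (he : ∀ i j, ∀ m : ℤ, e i - e j = m → i = j)
    (hθ : Dense {w | ∃ n, ∃ m : ℤ, w = θ n + m}) (hF : Function.Injective F)
    {X : Set ((Fin k → ℤ) → Δ)} (hX : X = colorWord F '' liftSet e θ)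
    (hmap : ∀ g, Set.MapsTo (shiftZk g) X X) :
    ∃ R : CircularOrderRel X, (inferInstance : TopologicalSpace X) = intervalTopology R.rel ∧
      ∀ g, IsCOP R.rel R.rel (Set.MapsTo.restrict (shiftZk g) X X (hmap g)) := by
  subst hX
  have hc := isLiftChain_liftSet hd he hθ hF
  have hlift : ∀ a ∈ colorWord F '' liftSet e θ, ∃ A ∈ liftSet e θ, colorWord F A = a :=
    fun a ha => ha
  have := infinite_colorWord_liftSet hd he hθ hF
  have : CompactSpace (colorWord F '' liftSet e θ) :=
    isCompact_iff_compactSpace.1 (isCompact_colorWord_liftSet e θ F)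
  refine ⟨hc.circularOrder hlift, CircularOrderRel.eq_intervalTopology _ ?_, fun g =>
    CircularOrderRel.isCOP_of_injective _ ?_ ?_⟩
  · rintro ⟨_, A, hA, rfl⟩ ⟨_, B₀, hB₀, rfl⟩ hab
    obtain ⟨B, hB, hBB, h1, h2⟩ := hc.exists_lift hA hB₀ fun h => hab (Subtype.ext h)
    have hcpt : IsCompact (colorWord F '' (liftSet e θ ∩ Set.Icc B (A + fun _ => (d + 1 : ℤ)))) :=
      (isCompact_liftSet_Icc e θ _ _ hB (hc.add_one_mem hA)).image (continuous_colorWord F)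
    have hset : {x | (hc.circularOrder hlift).rel ⟨_, A, hA, rfl⟩ x ⟨_, B₀, hB₀, rfl⟩} =
        (Subtype.val ⁻¹' (colorWord F ''
          (liftSet e θ ∩ Set.Icc B (A + fun _ => (d + 1 : ℤ)))))ᶜ := by
      ext x
      have h3 := hc.not_liftRel_iff hA hB h1 h2 (hlift x.1 x.2)
      rw [hBB] at h3
      exact (not_iff_comm.1 h3).symm
    rw [hset]
    exact (hcpt.isClosed.preimage continuous_subtype_val).isOpen_compl
  · intro x y hxy
    refine Subtype.ext (funext fun n => ?_)
    simpa [shiftZk] using congrFun (congrArg Subtype.val hxy) (n - g)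
  · rintro ⟨a, ha⟩ ⟨b, hb⟩ ⟨c, hc'⟩ ⟨A, hA, B, hB, C, hC, rfl, rfl, rfl, h1, h2, h3⟩
    have hshift : ∀ {P Q : (Fin k → ℤ) → ℤ}, P < Q →
        (fun n => P (n + g)) < fun n => Q (n + g) := by
      intro P Q hPQ
      refine lt_of_le_of_ne (fun n => hPQ.le _) fun h => hPQ.ne (funext fun n => ?_)
      simpa using congrFun h (n - g)
    exact ⟨_, liftSet_shift e θ hA g, _, liftSet_shift e θ hB g, _, liftSet_shift e θ hC g,
      rfl, rfl, rfl, hshift h1, hshift h2, hshift h3⟩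

lemma exists_circularOrder_of_subsingleton {X : Type*} [TopologicalSpace X] [Subsingleton X] :
    ∃ R : CircularOrderRel X, (inferInstance : TopologicalSpace X) = intervalTopology R.rel ∧
      ∀ g : X → X, IsCOP R.rel R.rel g := by
  refine ⟨⟨fun _ _ _ => False, fun _ _ _ => id, fun _ _ _ => False.elim,
    fun _ _ _ _ => False.elim, fun a b _ h => absurd (Subsingleton.elim a b) h⟩,
    Subsingleton.elim _ _, fun g => ⟨fun _ _ _ => False.elim, fun a c _ =>
    Or.inl fun x _ => Subsingleton.elim _ _⟩⟩

end Subshift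

/-- Let `c₀, …, c_d` be pairwise distinct points of `𝕋` in cyclic
order, `f : 𝕋 → {0,…,d}` a proper coloring of the induced partition into arcs
`[cᵢ, cᵢ₊₁)`, `α₁,…,α_k` angles at least one of which is irrational, `z ∈ 𝕋`,
and `φ(n) = f(z + n₁α₁ + ⋯ + n_kα_k)` the induced Sturmian like coding.
Then the orbit closure `X_φ` of `φ` in `{0,…,d}^{ℤ^k}` is shift invariant,
the system `(ℤ^k, X_φ)` is minimal, `X_φ` carries a circular order whose
interval topology is the subspace topology making every shift c-order
preserving, and the system is tame (no continuous function has an independent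
sequence in its orbit). -/
theorem sturmian_like_subshift_minimal_circularly_ordered_tame
    (d k : ℕ)
    (c : Fin (d + 1) → AddCircle (1 : ℝ))
    (hc_inj : Function.Injective c)
    (hc_cyc : ∀ i j l : Fin (d + 1), cyclicFin i j l → stdCircRel (c i) (c j) (c l))
    (f : AddCircle (1 : ℝ) → Fin (d + 1))
    (hf_const : ∀ i : Fin (d + 1), ∀ x ∈ circleArc (c i) (c (i + 1)), f x = f (c i))
    (hf_proper : Function.Injective (fun i => f (c i)))
    (α : Fin k → ℝ) (hirr : ∃ j : Fin k, Irrational (α j))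
    (z : AddCircle (1 : ℝ))
    (φ : (Fin k → ℤ) → Fin (d + 1))
    (hφ : φ = fun n : Fin k → ℤ =>
      f (z + ∑ j : Fin k, (n j) • ((α j : ℝ) : AddCircle (1 : ℝ))))
    (Xφ : Set ((Fin k → ℤ) → Fin (d + 1)))
    (hXφ : Xφ = closure {ω | ∃ g : Fin k → ℤ, ω = shiftZk g φ}) :
    ∃ hmap : ∀ g : Fin k → ℤ, Set.MapsTo (shiftZk g) Xφ Xφ,
      (∀ ω ∈ Xφ, Xφ ⊆ closure {ω' | ∃ g : Fin k → ℤ, ω' = shiftZk g ω}) ∧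
      (∃ R : CircularOrderRel Xφ,
        (inferInstance : TopologicalSpace Xφ) = intervalTopology R.rel ∧
        ∀ g : Fin k → ℤ,
          IsCOP R.rel R.rel (Set.MapsTo.restrict (shiftZk g) Xφ Xφ (hmap g))) ∧
      (∀ F : Xφ → ℝ, Continuous F →
        ¬ ∃ g : ℕ → Fin k → ℤ, IsIndepSeq
          (fun n (ω : Xφ) => F (Set.MapsTo.restrict (shiftZk (g n)) Xφ Xφ (hmap (g n)) ω))) := by

  set θ := angleHom α with hθdef
  set e := arcOffset c with he_def
  set F : Fin (d + 1) → Fin (d + 1) := fun i => f (c i) with hF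
  have hθ := dense_angleHom hirr
  have he := arcOffset_eq_of_sub_int hc_inj
  obtain ⟨x, rfl⟩ : ∃ x : ℝ, z = ((circleRep (c 0) + x : ℝ) : AddCircle (1 : ℝ)) :=
    ⟨circleRep z - circleRep (c 0), by rw [add_sub_cancel, coe_circleRep]⟩
  have hφF : φ = colorWord F (codeLift e θ true x) := by
    rw [hφ]
    funext n
    have hsum : ∑ j, (n j) • ((α j : ℝ) : AddCircle (1 : ℝ)) = ((θ n : ℝ) : AddCircle (1 : ℝ)) := by
      simp only [hθdef, angleHom, AddMonoidHom.mk'_apply, ← zsmul_eq_mul]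
      exact (map_sum (QuotientAddGroup.mk' (AddSubgroup.zmultiples (1 : ℝ)))
        (fun j => n j • α j) Finset.univ).symm
    rw [hsum, ← AddCircle.coe_add, add_assoc]
    exact color_eq_stepColor hc_inj hc_cyc hf_const _
  have hX : Xφ = colorWord F '' liftSet e θ := by
    rw [hXφ, hφF, closure_orbit_colorWord F hθ]
  have hmap : ∀ g : Fin k → ℤ, Set.MapsTo (shiftZk g) Xφ Xφ := by
    rw [hX]
    rintro g _ ⟨_, ⟨s, y, rfl⟩, rfl⟩
    rw [shiftZk_colorWord]
    exact ⟨_, codeLift_mem_liftSet e θ s _, rfl⟩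
  refine ⟨hmap, ?_, ?_, ?_⟩
  · intro ω hω
    rw [hX] at hω
    obtain ⟨_, ⟨s, y, rfl⟩, rfl⟩ := hω
    rw [closure_orbit_colorWord F hθ, hX]
  · rcases eq_or_ne d 0 with rfl | hd
    · have : Subsingleton Xφ := ⟨fun a b => Subtype.ext (funext fun n => Fin.ext (by omega))⟩
      obtain ⟨R, hR, hcop⟩ := exists_circularOrder_of_subsingleton (X := Xφ)
      exact ⟨R, hR, fun g => hcop _⟩
    · exact exists_circularOrder hd he hθ hf_proper hX hmap
  · rintro G hG ⟨g, hind⟩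
    have hcpt : IsCompact Xφ := by
      rw [hX]
      exact isCompact_colorWord_liftSet e θ F
    refine not_isIndepSeq_of_lift hcpt (q := stepColor F)
      (fun P hP Q hQ => liftSet_chain e θ hP hQ) (codeLift e θ false 0) (d + 1) ?_
      (fun g => Set.MapsTo.restrict (shiftZk g) Xφ Xφ (hmap g)) (fun _ _ _ => rfl) hG g hind
    intro ω hω
    rw [hX] at hω
    obtain ⟨s, y, hy0, hy1, rfl⟩ := exists_codeLift_unit e θ F hω
    refine ⟨_, codeLift_mem_liftSet e θ s y, rfl, ?_, ?_⟩
    · rcases hy0.eq_or_lt with rfl | hlt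
      · cases s
        · exact le_rfl
        · exact codeLift_false_le_true e θ 0
      · exact codeLift_le_of_lt e θ hlt _ _
    · have h := codeLift_le_of_lt e θ (show y < 0 + (1 : ℤ) by simpa using hy1) s false
      rw [codeLift_add_int] at h
      simpa using h
end

section
/- Let G be an infinite countable (discrete) group and let X be an infinite compact space whose topology is the interval topology of a circular order, on which G acts by c-order preserving homeomorphisms so that the G-system (G,X) is minimal. Then there exist a minimal action of G on the circle ℝ/ℤ by c-order preserving homeomorphisms and a continuous G-equivariant surjection π : X → ℝ/ℤ such that every fiber π^{-1}(y) has exactly one or exactly two points and the set A = {y : π^{-1}(y) has two points} is G-invariant. (That is, (G,X) is isomorphic to the split system Split(𝕋, G; A).) -/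
namespace CircularOrderRel

variable {X : Type*} (R : CircularOrderRel X)

theorem ne_of_rel {a b c : X} (h : R.rel a b c) : a ≠ b ∧ b ≠ c ∧ a ≠ c := by
  refine ⟨?_, ?_, ?_⟩
  · rintro rfl
    exact R.asymm _ _ _ h (R.cyclic _ _ _ h)
  · rintro rfl
    exact R.asymm _ _ _ h h
  · rintro rfl
    exact R.asymm _ _ _ h (R.cyclic _ _ _ (R.cyclic _ _ _ h))

/-- The ordered pair `(a, b)` is a gap of the circular order: the open interval it spans
is empty. -/
def IsGap (a b : X) : Prop := a ≠ b ∧ ∀ x, ¬ R.rel a x b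

variable {R}

theorem IsGap.right_unique {a b c : X} (h : R.IsGap a b) (h' : R.IsGap a c) : b = c := by
  by_contra hbc
  rcases R.total a b c h.1 hbc h'.1 with h1 | h1
  · exact h'.2 _ h1
  · exact h.2 _ h1

theorem IsGap.left_unique {a b c : X} (h : R.IsGap b a) (h' : R.IsGap c a) : b = c := by
  by_contra hbc
  rcases R.total b c a hbc h'.1 h.1 with h1 | h1
  · exact h.2 _ h1
  · exact h'.2 _ (R.cyclic _ _ _ (R.cyclic _ _ _ h1))

/-- If `b` ends a gap and starts another one, then `b` is isolated. -/
theorem IsGap.interval_eq_singleton {a b c : X} (h : R.IsGap a b) (h' : R.IsGap b c)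
    (hac : a ≠ c) : {x | R.rel a x c} = {b} := by
  ext x
  simp only [Set.mem_ofPred_eq, Set.mem_singleton_iff]
  constructor
  · intro hx
    by_contra hxb
    rcases R.total a b x h.1 (Ne.symm hxb) (R.ne_of_rel hx).1 with h1 | h1
    · exact h'.2 x (R.cyclic _ _ _ (R.cyclic _ _ _ (R.trans x c a b (R.cyclic _ _ _ hx)
        (R.cyclic _ _ _ (R.cyclic _ _ _ h1)))))
    · exact h.2 _ h1
  · rintro rfl
    rcases R.total a x c h.1 h'.1 hac with h1 | h1
    · exact h1
    · exact absurd h1 (h.2 c)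

variable (R)

/-- The linear order obtained by cutting a circular order at the point `p`, which becomes
the least element. -/
@[reducible] noncomputable def cutOrder (p : X) : LinearOrder X where
  le x y := x = y ∨ x = p ∨ R.rel p x y
  le_refl x := Or.inl rfl
  le_trans x y z := by
    rintro (rfl | rfl | h) h'
    · exact h'
    · exact Or.inr (Or.inl rfl)
    · rcases h' with rfl | rfl | h'
      · exact Or.inr (Or.inr h)
      · exact absurd rfl (R.ne_of_rel h).2.2
      · exact Or.inr (Or.inr (R.trans _ _ _ _ h h'))
  le_antisymm x y := by
    rintro (rfl | rfl | h) h'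
    · rfl
    · rcases h' with rfl | rfl | h'
      · rfl
      · rfl
      · exact absurd rfl (R.ne_of_rel h').2.2
    · rcases h' with rfl | rfl | h'
      · rfl
      · exact absurd rfl (R.ne_of_rel h).2.2
      · exact absurd h' (R.asymm _ _ _ h)
  le_total x y := by
    by_cases hx : x = p
    · exact Or.inl (Or.inr (Or.inl hx))
    by_cases hy : y = p
    · exact Or.inr (Or.inr (Or.inl hy))
    by_cases hxy : x = y
    · exact Or.inl (Or.inl hxy)
    rcases R.total p x y (Ne.symm hx) hxy (Ne.symm hy) with h | h
    · exact Or.inl (Or.inr (Or.inr h))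
    · exact Or.inr (Or.inr (Or.inr h))
  toDecidableLE := Classical.decRel _

theorem cutOrder_bot_le (p x : X) : (R.cutOrder p).le p x := Or.inr (Or.inl rfl)

theorem rel_of_cutOrder_lt (p : X) {x y z : X} (hxy : (R.cutOrder p).lt x y)
    (hyz : (R.cutOrder p).lt y z) : R.rel x y z := by
  let := R.cutOrder p
  change x < y at hxy
  change y < z at hyz
  have hy : y ≠ p := by
    rintro rfl
    exact absurd (R.cutOrder_bot_le y x) (not_le.mpr hxy)
  have h2 : R.rel p y z := by
    rcases hyz.le with h | h | h
    · exact absurd h hyz.ne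
    · exact absurd h hy
    · exact h
  rcases hxy.le with h | h | h
  · exact absurd h hxy.ne
  · exact h ▸ h2
  · exact R.cyclic _ _ _ (R.cyclic _ _ _ (R.trans y z p x (R.cyclic _ _ _ h2)
      (R.cyclic _ _ _ (R.cyclic _ _ _ h))))

theorem rel_iff_cutOrder (p : X) (x y z : X) : R.rel x y z ↔
    ((R.cutOrder p).lt x y ∧ (R.cutOrder p).lt y z) ∨
    ((R.cutOrder p).lt y z ∧ (R.cutOrder p).lt z x) ∨
    ((R.cutOrder p).lt z x ∧ (R.cutOrder p).lt x y) := by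
  let := R.cutOrder p
  have key : ∀ {x y z : X}, x < y → y < z → R.rel x y z := R.rel_of_cutOrder_lt p
  change _ ↔ (x < y ∧ y < z) ∨ (y < z ∧ z < x) ∨ (z < x ∧ x < y)
  constructor
  · intro h
    obtain ⟨h1, h2, h3⟩ := R.ne_of_rel h
    have h4 := R.asymm _ _ _ h
    rcases lt_or_gt_of_ne h1 with a | a <;> rcases lt_or_gt_of_ne h2 with b | b <;>
      rcases lt_or_gt_of_ne h3 with c | c
    · exact Or.inl ⟨a, b⟩
    · exact Or.inl ⟨a, b⟩
    · exact absurd (key c b) h4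
    · exact Or.inr (Or.inr ⟨c, a⟩)
    · exact absurd (R.cyclic _ _ _ (key a c)) h4
    · exact Or.inr (Or.inl ⟨b, c⟩)
    · exact absurd (R.cyclic _ _ _ (R.cyclic _ _ _ (key b a))) h4
    · exact absurd (R.cyclic _ _ _ (R.cyclic _ _ _ (key b a))) h4
  · rintro (⟨a, b⟩ | ⟨a, b⟩ | ⟨a, b⟩)
    · exact key a b
    · exact R.cyclic _ _ _ (R.cyclic _ _ _ (key a b))
    · exact R.cyclic _ _ _ (key a b)

end CircularOrderRel

/-- A linear order with least element `p` and a suitable countable set `E` admits a monotone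
map to `[0, 1]` which is strictly monotone on `E`. -/
theorem exists_monotone_unitInterval {α : Type*} [LinearOrder α] {p : α} (hp : ∀ x, p ≤ x)
    {E : Set α} (hEc : E.Countable) (hEn : E.Nonempty) (hpE : p ∉ E)
    (hE : ∀ x ∈ insert p E, ∀ y, x < y → ∃ d ∈ E, x < d ∧ d < y)
    (hmax : ∀ x ∈ E, ∃ d ∈ E, x < d) :
    ∃ F : α → ℝ, Monotone F ∧ (∀ x, 0 ≤ F x ∧ F x ≤ 1) ∧ StrictMonoOn F E ∧
      (∀ d ∈ E, 0 < F d ∧ F d < 1) ∧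
      (∀ x a, 0 ≤ a → a < F x → ∃ d ∈ E, d < x ∧ a < F d) ∧
      (∀ x b, b ≤ 1 → F x < b → ∃ d ∈ E, x < d ∧ F d < b) ∧
      (∀ q : ℚ, 0 < q → q < 1 → ∃ d ∈ E, F d = q) := by
  classical
  have : Countable E := hEc.to_subtype
  have : Nonempty E := hEn.to_subtype
  have : DenselyOrdered E := ⟨fun a b hab => by
    obtain ⟨d, hd, h1, h2⟩ := hE a (Or.inr a.2) b hab
    exact ⟨⟨d, hd⟩, h1, h2⟩⟩
  have : NoMaxOrder E := ⟨fun a => by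
    obtain ⟨d, hd, h1⟩ := hmax a a.2
    exact ⟨⟨d, hd⟩, h1⟩⟩
  have : NoMinOrder E := ⟨fun a => by
    obtain ⟨d, hd, h1, h2⟩ := hE p (Or.inl rfl) a
      (lt_of_le_of_ne (hp _) (fun h => hpE (h ▸ a.2)))
    exact ⟨⟨d, hd⟩, h2⟩⟩
  have : Nonempty (Set.Ioo (0 : ℚ) 1) := ⟨⟨1 / 2, by norm_num⟩⟩
  obtain ⟨e⟩ := Order.iso_of_countable_dense E (Set.Ioo (0 : ℚ) 1)
  let v : E → ℝ := fun d => ((e d : ℚ) : ℝ)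
  have hv0 : ∀ d, 0 < v d := fun d => Rat.cast_pos.mpr (e d).2.1
  have hv1 : ∀ d, v d < 1 := fun d => by
    have : ((e d : ℚ) : ℝ) < (1 : ℚ) := Rat.cast_lt.mpr (e d).2.2
    simpa [v] using this
  have hv : StrictMono v := fun a b hab => by
    have : (e a : ℚ) < e b := e.strictMono hab
    exact Rat.cast_lt.mpr this
  have hvq : ∀ q : ℚ, 0 < q → q < 1 → ∃ d, v d = q := fun q h0 h1 =>
    ⟨e.symm ⟨q, h0, h1⟩, by simp [v]⟩
  let S : α → Set ℝ := fun x => insert 0 (v '' {d | (d : α) ≤ x})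
  have hS1 : ∀ x, ∀ t ∈ S x, t ≤ 1 := by
    rintro x t (rfl | ⟨d, -, rfl⟩)
    · exact zero_le_one
    · exact (hv1 d).le
  have hSb : ∀ x, BddAbove (S x) := fun x => ⟨1, hS1 x⟩
  have hSn : ∀ x, (S x).Nonempty := fun x => ⟨0, Or.inl rfl⟩
  let F : α → ℝ := fun x => sSup (S x)
  have hF0 : ∀ x, 0 ≤ F x := fun x => le_csSup (hSb x) (Or.inl rfl)
  have hF1 : ∀ x, F x ≤ 1 := fun x => csSup_le (hSn x) (hS1 x)
  have hvF : ∀ (d : E) x, (d : α) ≤ x → v d ≤ F x := fun d x h =>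
    le_csSup (hSb x) (Or.inr ⟨d, h, rfl⟩)
  have hFE : ∀ d : E, F d = v d := fun d => by
    refine le_antisymm (csSup_le (hSn _) ?_) (hvF d d le_rfl)
    rintro t (rfl | ⟨d', hd', rfl⟩)
    · exact (hv0 d).le
    · exact hv.monotone hd'
  refine ⟨F, ?_, fun x => ⟨hF0 x, hF1 x⟩, ?_, ?_, ?_, ?_, ?_⟩
  · intro x y hxy
    refine csSup_le (hSn x) ?_
    rintro t (rfl | ⟨d, hd, rfl⟩)
    · exact hF0 y
    · exact hvF d y (le_trans hd hxy)
  · intro a ha b hb hab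
    rw [hFE ⟨a, ha⟩, hFE ⟨b, hb⟩]
    exact hv hab
  · intro d hd
    rw [hFE ⟨d, hd⟩]
    exact ⟨hv0 _, hv1 _⟩
  · intro x a ha hax
    obtain ⟨t, ht, hat⟩ := exists_lt_of_lt_csSup (hSn x) hax
    rcases ht with rfl | ⟨d, hd, rfl⟩
    · exact absurd hat (not_lt.mpr ha)
    · obtain ⟨q, hq, hq'⟩ := exists_rat_btwn hat
      obtain ⟨d', hd'⟩ := hvq q (by exact_mod_cast lt_of_le_of_lt ha hq)
        (by exact_mod_cast hq'.trans (hv1 d))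
      refine ⟨d', d'.2, lt_of_lt_of_le ?_ hd, ?_⟩
      · exact hv.lt_iff_lt.mp (hd' ▸ hq')
      · rw [hFE, hd']
        exact hq
  · intro x b hb hxb
    obtain ⟨q, hq, hq'⟩ := exists_rat_btwn hxb
    obtain ⟨d, hd⟩ := hvq q (by exact_mod_cast lt_of_le_of_lt (hF0 x) hq)
      (by exact_mod_cast hq'.trans_le hb)
    refine ⟨d, d.2, ?_, ?_⟩
    · by_contra h
      exact absurd (hvF d x (not_lt.mp h)) (by rw [hd]; exact not_le.mpr hq)
    · rw [hFE, hd]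
      exact hq'
  · intro q h0 h1
    obtain ⟨d, hd⟩ := hvq q h0 h1
    exact ⟨d, d.2, by rw [hFE, hd]⟩

theorem circleRep_coe_s12 {t : ℝ} (h0 : 0 ≤ t) (h1 : t < 1) : circleRep (t : AddCircle (1 : ℝ)) = t := by
  have : Fact ((0 : ℝ) < 1) := ⟨one_pos⟩
  have h := AddCircle.equivIco_coe_eq (p := (1 : ℝ)) (a := 0) (x := t) ⟨h0, by simpa using h1⟩
  simp only [circleRep]
  rw [h]

theorem coe_one_eq_coe_zero : ((1 : ℝ) : AddCircle (1 : ℝ)) = ((0 : ℝ) : AddCircle (1 : ℝ)) := by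
  rw [AddCircle.coe_period]
  rfl

theorem circleRep_coe_one : circleRep ((1 : ℝ) : AddCircle (1 : ℝ)) = 0 := by
  rw [coe_one_eq_coe_zero, circleRep_coe_s12 le_rfl one_pos]

theorem coe_circle_eq_iff {s t : ℝ} (hs : 0 ≤ s ∧ s ≤ 1) (ht : 0 ≤ t ∧ t ≤ 1) (hst : s ≤ t) :
    (s : AddCircle (1 : ℝ)) = t ↔ s = t ∨ (s = 0 ∧ t = 1) := by
  constructor
  · intro h
    have h' := congrArg circleRep h
    rcases eq_or_lt_of_le ht.2 with rfl | ht1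
    · rcases eq_or_lt_of_le hs.2 with rfl | hs1
      · exact Or.inl rfl
      · rw [circleRep_coe_s12 hs.1 hs1, circleRep_coe_one] at h'
        exact Or.inr ⟨h', rfl⟩
    · rw [circleRep_coe_s12 hs.1 (hst.trans_lt ht1), circleRep_coe_s12 ht.1 ht1] at h'
      exact Or.inl h'
  · rintro (rfl | ⟨rfl, rfl⟩)
    · rfl
    · exact coe_one_eq_coe_zero.symm

theorem stdCircRel_cyclic {x y z : AddCircle (1 : ℝ)} (h : stdCircRel x y z) :
    stdCircRel y z x := by
  unfold stdCircRel at *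
  linarith

theorem not_stdCircRel_of_stdCircRel {x y z : AddCircle (1 : ℝ)} (h : stdCircRel x y z) :
    ¬ stdCircRel x z y := by
  unfold stdCircRel at *
  linarith

theorem stdCircRel_ne {x y z : AddCircle (1 : ℝ)} (h : stdCircRel x y z) :
    x ≠ y ∧ y ≠ z ∧ x ≠ z := by
  unfold stdCircRel at h
  refine ⟨?_, ?_, ?_⟩ <;> rintro rfl <;> simp at h

theorem stdCircRel_coe {s t u : ℝ} (hs : 0 ≤ s) (hst : s ≤ t) (htu : t ≤ u) (hu : u ≤ 1)
    (h1 : (s : AddCircle (1 : ℝ)) ≠ t) (h2 : (t : AddCircle (1 : ℝ)) ≠ u)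
    (h3 : (s : AddCircle (1 : ℝ)) ≠ u) : stdCircRel s t u := by
  have hst' : s < t := lt_of_le_of_ne hst (by rintro rfl; exact h1 rfl)
  have htu' : t < u := lt_of_le_of_ne htu (by rintro rfl; exact h2 rfl)
  unfold stdCircRel
  rw [circleRep_coe_s12 hs (by linarith), circleRep_coe_s12 (by linarith) (by linarith)]
  rcases eq_or_lt_of_le hu with rfl | hu1
  · have hs' : 0 < s := lt_of_le_of_ne hs (by
      rintro rfl
      exact h3 coe_one_eq_coe_zero.symm)
    rw [circleRep_coe_one]
    have := mul_pos (mul_pos (sub_pos.mpr hst') (hs'.trans hst')) hs'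
    linarith
  · rw [circleRep_coe_s12 (by linarith) hu1]
    exact mul_pos (mul_pos (sub_pos.mpr hst') (sub_pos.mpr htu')) (sub_pos.mpr (hst'.trans htu'))

namespace CircularOrderRel

/-- Collapsing the gaps of a compact separable circularly ordered space yields the circle,
provided that no point of some countable dense set is the left end of a gap. -/
theorem exists_map_circle {X : Type*} [TopologicalSpace X] [CompactSpace X] [Nontrivial X]
    (R : CircularOrderRel X) (hopen : ∀ a b, IsOpen {x | R.rel a x b}) {D : Set X}
    (hDc : D.Countable) (hDd : Dense D) {p : X} (hp : p ∈ D)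
    (hD : ∀ d ∈ D, ∀ y, ¬ R.IsGap d y) :
    ∃ π : X → AddCircle (1 : ℝ), Continuous π ∧ Function.Surjective π ∧
      (∀ x y, π x = π y ↔ x = y ∨ R.IsGap x y ∨ R.IsGap y x) ∧
      (∀ x y z, R.rel x y z → π x ≠ π y → π y ≠ π z → π x ≠ π z →
        stdCircRel (π x) (π y) (π z)) := by
  have hfact : Fact ((0 : ℝ) < 1) := ⟨one_pos⟩
  let := R.cutOrder p
  have hrel : ∀ x y z, R.rel x y z ↔ (x < y ∧ y < z) ∨ (y < z ∧ z < x) ∨ (z < x ∧ x < y) :=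
    R.rel_iff_cutOrder p
  have hple : ∀ x, p ≤ x := R.cutOrder_bot_le p
  have hplt : ∀ x, x ≠ p → p < x := fun x hx => lt_of_le_of_ne (hple x) hx.symm
  have hnlt : ∀ x, ¬ x < p := fun x => not_lt.mpr (hple x)
  have hdense : ∀ a b, (∃ x, R.rel a x b) → ∃ d ∈ D, R.rel a d b := fun a b h => by
    obtain ⟨d, hd, hd'⟩ := hDd.exists_mem_open (hopen a b) h
    exact ⟨d, hd, hd'⟩
  have hnext : ∀ d ∈ D, ∀ y, d ≠ y → ∃ d' ∈ D, R.rel d d' y := fun d hd y hdy => by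
    refine hdense d y ?_
    by_contra h
    exact hD d hd y ⟨hdy, fun x hx => h ⟨x, hx⟩⟩
  let E : Set X := D \ {p}
  have hbtw : ∀ x y d, x < y → d ∈ D → R.rel x d y → d ∈ E ∧ x < d ∧ d < y := by
    intro x y d hxy hd h
    have : x < d ∧ d < y := by
      rcases (hrel x d y).mp h with h | h | h
      · exact h
      · exact absurd hxy h.2.not_gt
      · exact absurd hxy h.1.not_gt
    exact ⟨⟨hd, ((hple x).trans_lt this.1).ne'⟩, this⟩
  have hrtop : ∀ x d, R.rel x d p → d ≠ p ∧ x < d := by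
    intro x d h
    refine ⟨(R.ne_of_rel h).2.1, ?_⟩
    rcases (hrel x d p).mp h with h | h | h
    · exact h.1
    · exact absurd h.1 (hnlt _)
    · exact h.2
  have hE : ∀ x ∈ insert p E, ∀ y, x < y → ∃ d ∈ E, x < d ∧ d < y := by
    intro x hx y hxy
    have hxD : x ∈ D := by
      rcases hx with rfl | hx
      · exact hp
      · exact hx.1
    obtain ⟨d, hd, h⟩ := hnext x hxD y hxy.ne
    exact ⟨d, hbtw x y d hxy hd h⟩
  have hmax : ∀ x ∈ E, ∃ d ∈ E, x < d := by
    intro x hx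
    obtain ⟨d, hd, h⟩ := hnext x hx.1 p hx.2
    exact ⟨d, ⟨hd, (hrtop x d h).1⟩, (hrtop x d h).2⟩
  have hEn : E.Nonempty := by
    obtain ⟨y, hy⟩ := exists_ne p
    obtain ⟨d, hd, -⟩ := hE p (Or.inl rfl) y (hplt y hy)
    exact ⟨d, hd⟩
  obtain ⟨F, hmono, hF01, hFs, hFE, hlow, hupp, hFq⟩ :=
    exists_monotone_unitInterval hple (hDc.mono Set.sdiff_subset) hEn (fun h => h.2 rfl) hE hmax
  have hFp : F p = 0 := by
    by_contra h
    obtain ⟨d, -, hd, -⟩ := hlow p 0 le_rfl (lt_of_le_of_ne (hF01 p).1 (Ne.symm h))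
    exact hnlt d hd
  have hF0 : ∀ x, F x = 0 → x = p := by
    intro x hx
    by_contra h
    obtain ⟨d, hd, -, h2⟩ := hE p (Or.inl rfl) x (hplt x h)
    linarith [(hFE d hd).1, hmono h2.le]
  have hF1 : ∀ x, F x = 1 ↔ R.IsGap x p := by
    intro x
    constructor
    · intro hx
      refine ⟨?_, fun z hz => ?_⟩
      · rintro rfl
        linarith
      · obtain ⟨d, hd, hd'⟩ := hdense x p ⟨z, hz⟩
        obtain ⟨h1, h2⟩ := hrtop x d hd'
        linarith [(hFE d ⟨hd, h1⟩).2, hmono h2.le]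
    · intro hx
      by_contra h
      obtain ⟨d, hd, hxd, -⟩ := hupp x 1 le_rfl (lt_of_le_of_ne (hF01 x).2 h)
      exact hx.2 d ((hrel x d p).mpr (Or.inr (Or.inr ⟨hplt x hx.1, hxd⟩)))
  have hFeq : ∀ x y, x < y → (F x = F y ↔ R.IsGap x y) := by
    intro x y hxy
    constructor
    · intro h
      refine ⟨hxy.ne, fun z hz => ?_⟩
      obtain ⟨d, hd, hd'⟩ := hdense x y ⟨z, hz⟩
      obtain ⟨h1, h2, h3⟩ := hbtw x y d hxy hd hd'
      obtain ⟨d', h4, h5, h6⟩ := hE d (Or.inr h1) y h3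
      linarith [hFs h1 h4 h5, hmono h2.le, hmono h6.le]
    · intro h
      refine le_antisymm (hmono hxy.le) ?_
      by_contra h'
      obtain ⟨d, -, h1, h2⟩ := hupp x (F y) (hF01 y).2 (not_le.mp h')
      exact h.2 d ((hrel x d y).mpr (Or.inl ⟨h1, hmono.reflect_lt h2⟩))
  have hgap : ∀ x y, x < y →
      ((F x : AddCircle (1 : ℝ)) = F y ↔ x = y ∨ R.IsGap x y ∨ R.IsGap y x) := by
    intro x y hxy
    rw [coe_circle_eq_iff (hF01 x) (hF01 y) (hmono hxy.le), hFeq x y hxy, hF1 y]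
    constructor
    · rintro (h | ⟨h, h'⟩)
      · exact Or.inr (Or.inl h)
      · exact Or.inr (Or.inr (hF0 x h ▸ h'))
    · rintro (h | h | h)
      · exact absurd h hxy.ne
      · exact Or.inl h
      · have : x = p := by
          by_contra hx
          exact h.2 p ((hrel y p x).mpr (Or.inr (Or.inl ⟨hplt x hx, hxy⟩)))
        subst this
        exact Or.inr ⟨hFp, h⟩
  have hcont : Continuous fun x => (F x : AddCircle (1 : ℝ)) := by
    rw [continuous_iff_continuousAt]
    intro x
    by_cases hx : x = p
    · subst hx
      let F' : X → ℝ := fun y => if F y < 1 / 2 then F y else F y - 1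
      have hF' : (fun y => (F y : AddCircle (1 : ℝ))) = fun y => (F' y : AddCircle (1 : ℝ)) := by
        funext y
        by_cases hy : F y < 1 / 2
        · simp only [F', hy, if_true]
        · simp only [F', hy, if_false]
          rw [AddCircle.coe_sub, AddCircle.coe_period, sub_zero]
      have hF'x : F' x = 0 := by simp [F', hFp]
      have ht : Filter.Tendsto F' (nhds x) (nhds (F' x)) := by
        rw [hF'x, Metric.tendsto_nhds]
        intro ε hε
        obtain ⟨q, hq0, hq⟩ := exists_rat_btwn (show (0 : ℝ) < min ε (1 / 2) by positivity)
        have hqε := hq.trans_le (min_le_left _ _)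
        have hq2 := hq.trans_le (min_le_right _ _)
        have hq0' : (0 : ℚ) < q := by exact_mod_cast hq0
        have hq1' : q < 1 := by
          have : (q : ℝ) < 1 := by linarith
          exact_mod_cast this
        obtain ⟨d, hd, hdq⟩ := hFq q hq0' hq1'
        obtain ⟨d', hd', hdq'⟩ := hFq (1 - q) (by linarith) (by linarith)
        push_cast at hdq'
        have hdd : d < d' := (hFs.lt_iff_lt hd hd').mp (by linarith)
        have hmem : {y | R.rel d' y d} ∈ nhds x := (hopen d' d).mem_nhds
          ((hrel d' x d).mpr (Or.inr (Or.inl ⟨hplt d hd.2, hdd⟩)))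
        filter_upwards [hmem] with y hy
        rw [Real.dist_eq, sub_zero, abs_lt]
        have h01 := hF01 y
        rcases (hrel d' y d).mp hy with h | h | h
        · exact absurd hdd (h.1.trans h.2).not_gt
        · have := hmono h.1.le
          have h3 : F y < 1 / 2 := by linarith
          simp only [F', h3, if_true]
          constructor <;> linarith
        · have := hmono h.2.le
          have h3 : ¬ F y < 1 / 2 := by linarith
          simp only [F', h3, if_false]
          constructor <;> linarith
      change Filter.Tendsto (fun y => (F y : AddCircle (1 : ℝ))) (nhds x)
        (nhds (F x : AddCircle (1 : ℝ)))
      have h := ((AddCircle.continuous_mk' (1 : ℝ)).tendsto (F' x)).comp ht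
      have hFF : (F x : AddCircle (1 : ℝ)) = F' x := congrFun hF' x
      rw [hF', hFF]
      exact h
    · have ht : Filter.Tendsto F (nhds x) (nhds (F x)) := by
        rw [tendsto_order]
        constructor
        · intro a ha
          by_cases ha0 : 0 ≤ a
          · obtain ⟨d, hd, hdx, had⟩ := hlow x a ha0 ha
            filter_upwards [(hopen d p).mem_nhds
              ((hrel d x p).mpr (Or.inr (Or.inr ⟨hplt d hd.2, hdx⟩)))] with y hy
            exact had.trans_le (hmono (hrtop d y hy).2.le)
          · exact Filter.Eventually.of_forall fun y => (not_le.mp ha0).trans_le (hF01 y).1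
        · intro b hb
          by_cases hb1 : b ≤ 1
          · obtain ⟨d, hd, hdx, had⟩ := hupp x b hb1 hb
            filter_upwards [(hopen p d).mem_nhds
              ((hrel p x d).mpr (Or.inl ⟨hplt x hx, hdx⟩))] with y hy
            refine lt_of_le_of_lt (hmono ?_) had
            rcases (hrel p y d).mp hy with h | h | h
            · exact h.2.le
            · exact absurd h.2 (hnlt _)
            · exact absurd h.1 (hnlt _)
          · exact Filter.Eventually.of_forall fun y => (hF01 y).2.trans_lt (not_le.mp hb1)
      exact ((AddCircle.continuous_mk' (1 : ℝ)).tendsto (F x)).comp ht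
  refine ⟨fun x => (F x : AddCircle (1 : ℝ)), hcont, ?_, ?_, ?_⟩
  · intro t
    have hcl : IsClosed (Set.range fun x => (F x : AddCircle (1 : ℝ))) :=
      (isCompact_range hcont).isClosed
    have hmk : IsClosed {s : ℝ | (s : AddCircle (1 : ℝ)) ∈
        Set.range fun x => (F x : AddCircle (1 : ℝ))} :=
      hcl.preimage (AddCircle.continuous_mk' (1 : ℝ))
    have hIoo : Set.Ioo (0 : ℝ) 1 ⊆ {s : ℝ | (s : AddCircle (1 : ℝ)) ∈
        Set.range fun x => (F x : AddCircle (1 : ℝ))} := by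
      intro s hs
      refine closure_minimal ?_ hmk
        (Rat.denseRange_cast.open_subset_closure_inter isOpen_Ioo hs)
      rintro _ ⟨hq, q, rfl⟩
      obtain ⟨d, -, hd⟩ := hFq q (by exact_mod_cast hq.1) (by exact_mod_cast hq.2)
      exact ⟨d, by simp only [hd]⟩
    obtain ⟨s, hs, rfl⟩ : ∃ s ∈ Set.Ico (0 : ℝ) (0 + 1), (s : AddCircle (1 : ℝ)) = t := by
      have := AddCircle.coe_image_Ico_eq (1 : ℝ) 0
      have h : t ∈ ((↑) : ℝ → AddCircle (1 : ℝ)) '' Set.Ico (0 : ℝ) (0 + 1) := this ▸ Set.mem_univ t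
      exact h
    rcases eq_or_lt_of_le hs.1 with rfl | h0
    · exact ⟨p, by simp only [hFp]⟩
    · exact hIoo ⟨h0, by linarith [hs.2]⟩
  · intro x y
    rcases lt_trichotomy x y with h | rfl | h
    · exact hgap x y h
    · simp
    · rw [eq_comm, hgap y x h, eq_comm, or_comm (a := R.IsGap y x)]
  · have key : ∀ x y z, x < y → y < z → (F x : AddCircle (1 : ℝ)) ≠ F y →
        (F y : AddCircle (1 : ℝ)) ≠ F z → (F x : AddCircle (1 : ℝ)) ≠ F z →
        stdCircRel (F x) (F y) (F z) := fun x y z hxy hyz =>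
      stdCircRel_coe (hF01 x).1 (hmono hxy.le) (hmono hyz.le) (hF01 z).2
    intro x y z h h1 h2 h3
    rcases (hrel x y z).mp h with h | h | h
    · exact key x y z h.1 h.2 h1 h2 h3
    · exact stdCircRel_cyclic (stdCircRel_cyclic (key y z x h.1 h.2 h2 h3.symm h1.symm))
    · exact stdCircRel_cyclic (key z x y h.1 h.2 h3.symm h1 h2.symm)

end CircularOrderRel

/-- A minimal system on an infinite compact space has no isolated points. -/
theorem not_isOpen_singleton_of_minimal {G X : Type*} [Group G] [TopologicalSpace X]
    [CompactSpace X] [Infinite X] [MulAction G X]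
    (hcont : ∀ g : G, Continuous (fun x : X => g • x))
    (hmin : ∀ x : X, Dense {y : X | ∃ g : G, y = g • x}) (x : X) : ¬ IsOpen ({x} : Set X) := by
  intro hx
  have hall : ∀ y : X, IsOpen ({y} : Set X) := by
    intro y
    obtain ⟨_, ⟨g, rfl⟩, hz⟩ := (hmin y).exists_mem_open hx ⟨x, rfl⟩
    have hz' : g • y = x := hz
    convert hx.preimage (hcont g) using 1
    ext w
    simp [← hz']
  have : DiscreteTopology X := discreteTopology_iff_isOpen_singleton.mpr hall
  have : Finite X := finite_of_compact_of_discrete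
  exact not_finite X

/-- An infinite circularly ordered minimal compact system
`(G,X)`, for an infinite countable group `G` acting by c-order preserving
homeomorphisms, is isomorphic to a split system `Split(𝕋, G; A)`: there are
a minimal `G`-action on the circle `ℝ/ℤ` by c-order preserving homeomorphisms
and a continuous equivariant surjection `π : X → ℝ/ℤ` whose fibers have one
or two points, the set of two-point fibers being `G`-invariant. -/
theorem minimal_circularly_ordered_G_system_is_split_of_circle
    {G X : Type*} [Group G] [Countable G] [Infinite G]
    [tX : TopologicalSpace X] [CompactSpace X] [Infinite X]
    [MulAction G X]
    (R : CircularOrderRel X)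
    (htop : tX = intervalTopology R.rel)
    (hcont : ∀ g : G, Continuous (fun x : X => g • x))
    (hcop : ∀ g : G, IsCOP R.rel R.rel (fun x : X => g • x))
    (hmin : ∀ x : X, Dense {y : X | ∃ g : G, y = g • x}) :
    ∃ (ρ : G → (AddCircle (1 : ℝ) ≃ₜ AddCircle (1 : ℝ)))
      (π : X → AddCircle (1 : ℝ)),
      ρ 1 = Homeomorph.refl _ ∧
      (∀ g h : G, ρ (g * h) = (ρ h).trans (ρ g)) ∧
      (∀ g : G, IsCOP stdCircRel stdCircRel (⇑(ρ g))) ∧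
      (∀ y : AddCircle (1 : ℝ), Dense {y' | ∃ g : G, y' = ρ g y}) ∧
      Continuous π ∧ Function.Surjective π ∧
      (∀ (g : G) (x : X), π (g • x) = ρ g (π x)) ∧
      (∀ y : AddCircle (1 : ℝ),
        (∃ x : X, π ⁻¹' {y} = {x}) ∨
        (∃ x₁ x₂ : X, x₁ ≠ x₂ ∧ π ⁻¹' {y} = {x₁, x₂})) ∧
      (∀ (g : G) (y : AddCircle (1 : ℝ)),
        (∃ x₁ x₂ : X, x₁ ≠ x₂ ∧ π ⁻¹' {y} = {x₁, x₂}) →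
        (∃ x₁ x₂ : X, x₁ ≠ x₂ ∧ π ⁻¹' {ρ g y} = {x₁, x₂})) := by
  have hopen : ∀ a b, IsOpen {x | R.rel a x b} := by
    intro a b
    by_cases hab : a = b
    · have : {x | R.rel a x b} = ∅ := by
        ext x
        simp only [Set.mem_ofPred_eq, Set.mem_empty_iff_false, iff_false]
        exact fun h => (R.ne_of_rel h).2.2 hab
      rw [this]
      exact isOpen_empty
    · subst htop
      exact TopologicalSpace.isOpen_generateFrom_of_mem ⟨a, b, hab, rfl⟩
  have hrel : ∀ (g : G) a b c, R.rel a b c → R.rel (g • a) (g • b) (g • c) := by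
    intro g a b c h
    obtain ⟨h1, h2, h3⟩ := R.ne_of_rel h
    exact (hcop g).1 a b c h (fun h => h1 (smul_left_cancel g h))
      (fun h => h2 (smul_left_cancel g h)) (fun h => h3 (smul_left_cancel g h))
  have hgap : ∀ (g : G) a b, R.IsGap a b → R.IsGap (g • a) (g • b) := by
    intro g a b h
    refine ⟨fun h' => h.1 (smul_left_cancel g h'), fun x hx => h.2 (g⁻¹ • x) ?_⟩
    simpa using hrel g⁻¹ _ _ _ hx
  have hiso := not_isOpen_singleton_of_minimal hcont hmin
  have hgap2 : ∀ a b c, R.IsGap a b → ¬ R.IsGap b c := by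
    intro a b c h h'
    by_cases hac : a = c
    · subst hac
      obtain ⟨x, hx⟩ := (Set.toFinite ({a, b} : Set X)).exists_notMem
      simp only [Set.mem_insert_iff, Set.mem_singleton_iff, not_or] at hx
      rcases R.total a x b (Ne.symm hx.1) hx.2 h.1 with h1 | h1
      · exact h.2 x h1
      · exact h'.2 x (R.cyclic _ _ _ h1)
    · exact hiso b (h.interval_eq_singleton h' hac ▸ hopen a c)
  obtain ⟨p, hp⟩ : ∃ p : X, ∀ y, ¬ R.IsGap p y := by
    obtain ⟨x⟩ := (inferInstance : Nonempty X)
    by_cases h : ∃ y, R.IsGap x y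
    · obtain ⟨y, hy⟩ := h
      exact ⟨y, fun z => hgap2 x y z hy⟩
    · exact ⟨x, fun y hy => h ⟨y, hy⟩⟩
  have hDc : {y : X | ∃ g : G, y = g • p}.Countable := by
    have : {y : X | ∃ g : G, y = g • p} = Set.range fun g : G => g • p := by
      ext y
      simp [eq_comm]
    rw [this]
    exact Set.countable_range _
  obtain ⟨π, hπc, hπs, hπ, hπr⟩ := R.exists_map_circle hopen hDc (hmin p)
    ⟨1, (one_smul G p).symm⟩ (by
      rintro _ ⟨g, rfl⟩ y hy
      refine hp (g⁻¹ • y) ?_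
      simpa using hgap g⁻¹ _ _ hy)
  have hfact : Fact ((0 : ℝ) < 1) := ⟨one_pos⟩
  have hinv : ∀ (g : G) x y, π x = π y → π (g • x) = π (g • y) := by
    intro g x y h
    rcases (hπ x y).mp h with rfl | h | h
    · rfl
    · exact (hπ _ _).mpr (Or.inr (Or.inl (hgap g _ _ h)))
    · exact (hπ _ _).mpr (Or.inr (Or.inr (hgap g _ _ h)))
  have hstd : ∀ x y z, stdCircRel (π x) (π y) (π z) → R.rel x y z := by
    intro x y z h
    obtain ⟨h1, h2, h3⟩ := stdCircRel_ne h
    rcases R.total x y z (fun h => h1 (h ▸ rfl)) (fun h => h2 (h ▸ rfl))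
      (fun h => h3 (h ▸ rfl)) with h' | h'
    · exact h'
    · exact absurd (hπr x z y h' h3 h2.symm h1) (not_stdCircRel_of_stdCircRel h)
  have hquot : Topology.IsQuotientMap π :=
    Topology.IsQuotientMap.of_surjective_continuous hπs hπc
  let f : G → AddCircle (1 : ℝ) → AddCircle (1 : ℝ) := fun g t => π (g • Function.surjInv hπs t)
  have hf : ∀ g x, f g (π x) = π (g • x) := fun g x =>
    hinv g _ _ (Function.surjInv_eq hπs (π x))
  have hfc : ∀ g, Continuous (f g) := by
    intro g
    rw [hquot.continuous_iff]
    have : f g ∘ π = fun x => π (g • x) := funext (hf g)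
    rw [this]
    exact hπc.comp (hcont g)
  have hf1 : ∀ t, f 1 t = t := by
    intro t
    obtain ⟨x, rfl⟩ := hπs t
    rw [hf, one_smul]
  have hfmul : ∀ g h t, f (g * h) t = f g (f h t) := by
    intro g h t
    obtain ⟨x, rfl⟩ := hπs t
    simp only [hf, mul_smul]
  let ρ : G → (AddCircle (1 : ℝ) ≃ₜ AddCircle (1 : ℝ)) := fun g =>
    { toFun := f g
      invFun := f g⁻¹
      left_inv := fun t => by rw [← hfmul, inv_mul_cancel, hf1]
      right_inv := fun t => by rw [← hfmul, mul_inv_cancel, hf1]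
      continuous_toFun := hfc g
      continuous_invFun := hfc g⁻¹ }
  have hρ : ∀ g x, π (g • x) = ρ g (π x) := fun g x => (hf g x).symm
  refine ⟨ρ, π, Homeomorph.ext hf1, fun g h => Homeomorph.ext (hfmul g h), ?_, ?_, hπc, hπs,
    hρ, ?_, ?_⟩
  · intro g
    refine ⟨fun a b c h h1 h2 h3 => ?_, fun a c h => Or.inl fun x hx => ?_⟩
    · obtain ⟨x, rfl⟩ := hπs a
      obtain ⟨y, rfl⟩ := hπs b
      obtain ⟨z, rfl⟩ := hπs c
      simp only [← hρ] at h1 h2 h3 ⊢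
      exact hπr _ _ _ (hrel g _ _ _ (hstd x y z h)) h1 h2 h3
    · have hac : a = c := (ρ g).injective h
      subst hac
      rcases hx with (rfl | rfl) | hx
      · rfl
      · rfl
      · exact absurd rfl (stdCircRel_ne hx).2.2
  · intro t
    obtain ⟨x, rfl⟩ := hπs t
    refine (hπs.denseRange.dense_image hπc (hmin x)).mono ?_
    rintro _ ⟨_, ⟨g, rfl⟩, rfl⟩
    exact ⟨g, hρ g x⟩
  · intro t
    obtain ⟨x, rfl⟩ := hπs t
    by_cases h : ∃ y, R.IsGap x y
    · obtain ⟨y, hy⟩ := h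
      refine Or.inr ⟨x, y, hy.1, ?_⟩
      ext z
      simp only [Set.mem_preimage, Set.mem_singleton_iff, Set.mem_insert_iff, hπ]
      constructor
      · rintro (h | h | h)
        · exact Or.inl h
        · exact absurd hy (hgap2 _ _ _ h)
        · exact Or.inr (h.right_unique hy)
      · rintro (rfl | rfl)
        · exact Or.inl rfl
        · exact Or.inr (Or.inr hy)
    by_cases h' : ∃ y, R.IsGap y x
    · obtain ⟨y, hy⟩ := h'
      refine Or.inr ⟨x, y, hy.1.symm, ?_⟩
      ext z
      simp only [Set.mem_preimage, Set.mem_singleton_iff, Set.mem_insert_iff, hπ]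
      constructor
      · rintro (h1 | h1 | h1)
        · exact Or.inl h1
        · exact Or.inr (h1.left_unique hy)
        · exact absurd ⟨z, h1⟩ h
      · rintro (rfl | rfl)
        · exact Or.inl rfl
        · exact Or.inr (Or.inl hy)
    refine Or.inl ⟨x, ?_⟩
    ext z
    simp only [Set.mem_preimage, Set.mem_singleton_iff, hπ]
    constructor
    · rintro (h1 | h1 | h1)
      · exact h1
      · exact absurd ⟨z, h1⟩ h'
      · exact absurd ⟨z, h1⟩ h
    · exact Or.inl
  · rintro g t ⟨x₁, x₂, hne, h⟩
    refine ⟨g • x₁, g • x₂, fun h' => hne (smul_left_cancel g h'), ?_⟩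
    ext z
    have h1 : π z = ρ g t ↔ π (g⁻¹ • z) = t := by
      rw [← (ρ g).injective.eq_iff (a := π (g⁻¹ • z)), ← hρ, smul_inv_smul]
    have h2 : π (g⁻¹ • z) = t ↔ g⁻¹ • z = x₁ ∨ g⁻¹ • z = x₂ := Set.ext_iff.mp h (g⁻¹ • z)
    simp only [Set.mem_preimage, Set.mem_singleton_iff, Set.mem_insert_iff, h1, h2,
      inv_smul_eq_iff]
end

section
/- Let (X,R) be a circularly ordered set, with its interval topology τ_R, and let c ∈ X. Define X(c) := X ⊔ {c⁺} with the linear order in which c is the least element, c⁺ is the greatest element, and for a,b ∈ X∖{c}, a < b iff [c,a,b]. Let q : X(c) → X be the map with q(c⁺) = c and q(x) = x for x ∈ X. Then: (a) this relation is indeed a linear order on X(c); (b) q is continuous from the interval (order) topology of X(c) to τ_R; (c) q is c-order preserving with respect to the circular order induced by the linear order on X(c); and (d) if τ_R is compact then X(c) is compact. -/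
/-- The strict order of the cut space `X(c) = X ⊔ {c⁺}` of a circularly
ordered set at a point `c`: `c` is the least element, the added point `c⁺`
(represented by `Sum.inr ()`) is the greatest element, and for
`a, b ∈ X ∖ {c}` we have `a < b` iff `[c,a,b]`. -/
def cutLT {X : Type*} (R : CircularOrderRel X) (c : X)
    (x y : X ⊕ Unit) : Prop :=
  match x, y with
  | Sum.inl a, Sum.inl b => (a = c ∧ b ≠ c) ∨ (a ≠ c ∧ b ≠ c ∧ R.rel c a b)
  | Sum.inl _, Sum.inr _ => True
  | Sum.inr _, _ => False

/-- The interval (order) topology of a strict order relation, generated by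
the open rays. -/
def rayTopology {Y : Type*} (lt : Y → Y → Prop) : TopologicalSpace Y :=
  TopologicalSpace.generateFrom
    ({s | ∃ a : Y, s = {x | lt a x}} ∪ {s | ∃ b : Y, s = {x | lt x b}})

/-- The circular order canonically induced by a strict linear order. -/
def circOfLT {Y : Type*} (lt : Y → Y → Prop) (x y z : Y) : Prop :=
  (lt x y ∧ lt y z) ∨ (lt y z ∧ lt z x) ∨ (lt z x ∧ lt x y)

/-- The projection `q : X(c) → X` identifying the two end points with `c`. -/
def cutProj {X : Type*} (c : X) : X ⊕ Unit → X :=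
  Sum.elim id (fun _ => c)

namespace CircularOrderRel

variable {X : Type*} (R : CircularOrderRel X) (c : X)

theorem not_rel_right (a b : X) : ¬ R.rel a b b := fun h => R.asymm _ _ _ h h

theorem not_rel_left (a b : X) : ¬ R.rel a a b :=
  fun h => R.not_rel_right b a (R.cyclic _ _ _ (R.cyclic _ _ _ h))

theorem not_rel_outer (a b : X) : ¬ R.rel a b a :=
  fun h => R.not_rel_left a b (R.cyclic _ _ _ (R.cyclic _ _ _ h))

variable {R c}

theorem cutLT_inl {a b : X} :
    cutLT R c (Sum.inl a) (Sum.inl b) ↔ (a = c ∧ b ≠ c) ∨ R.rel c a b := by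
  have := R.not_rel_left c b
  have := R.not_rel_outer c a
  simp only [cutLT]
  grind

@[simp] theorem cutLT_inl_inr (a : X) (u : Unit) : cutLT R c (Sum.inl a) (Sum.inr u) := trivial

@[simp] theorem not_cutLT_inr (u : Unit) (y : X ⊕ Unit) : ¬ cutLT R c (Sum.inr u) y := by
  simp [cutLT]

@[simp] theorem not_cutLT_base (y : X ⊕ Unit) : ¬ cutLT R c y (Sum.inl c) := by
  rcases y with a | u
  · simp [cutLT_inl, R.not_rel_outer]
  · simp

theorem cutLT_base {a : X} (ha : a ≠ c) : cutLT R c (Sum.inl c) (Sum.inl a) :=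
  cutLT_inl.2 (Or.inl ⟨rfl, ha⟩)

variable (R c)

theorem cutLT_irrefl (x : X ⊕ Unit) : ¬ cutLT R c x x := by
  rcases x with a | u
  · have := R.not_rel_right c a
    rw [cutLT_inl]
    tauto
  · simp

variable {R c}

theorem cutLT_trans {x y z : X ⊕ Unit} (hxy : cutLT R c x y) (hyz : cutLT R c y z) :
    cutLT R c x z := by
  rcases x with x | x <;> rcases y with y | y <;> rcases z with z | z <;> simp_all [cutLT_inl]
  have := R.not_rel_outer c y
  grind [R.trans, R.cyclic, R.asymm, R.not_rel_outer]

theorem cutLT_total {x y : X ⊕ Unit} (h : x ≠ y) : cutLT R c x y ∨ cutLT R c y x := by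
  rcases x with x | x <;> rcases y with y | y <;> simp_all [cutLT_inl]
  have := R.total c x y
  grind

/-- On `X`, the circular order is the one induced by the linear order of the cut. -/
theorem rel_iff_circOfLT {x y z : X} :
    R.rel x y z ↔ circOfLT (cutLT R c) (Sum.inl x) (Sum.inl y) (Sum.inl z) := by
  have rel_of_lt {x y z : X} (hxy : cutLT R c (Sum.inl x) (Sum.inl y))
      (hyz : cutLT R c (Sum.inl y) (Sum.inl z)) : R.rel x y z := by
    have := R.not_rel_outer c y
    rw [cutLT_inl] at hxy hyz
    grind [R.trans, R.cyclic]
  have rel_of_circ {x y z : X}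
      (h : circOfLT (cutLT R c) (Sum.inl x) (Sum.inl y) (Sum.inl z)) : R.rel x y z := by
    rcases h with ⟨h, h'⟩ | ⟨h, h'⟩ | ⟨h, h'⟩
    · exact rel_of_lt h h'
    · exact R.cyclic _ _ _ (R.cyclic _ _ _ (rel_of_lt h h'))
    · exact R.cyclic _ _ _ (rel_of_lt h h')
  refine ⟨fun h => ?_, rel_of_circ⟩
  have hxy : x ≠ y := by rintro rfl; exact R.not_rel_left _ _ h
  have hyz : y ≠ z := by rintro rfl; exact R.not_rel_right _ _ h
  have hxz : x ≠ z := by rintro rfl; exact R.not_rel_outer _ _ h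
  have h1 := cutLT_total (R := R) (c := c) (Sum.inl_injective.ne hxy)
  have h2 := cutLT_total (R := R) (c := c) (Sum.inl_injective.ne hyz)
  have h3 := cutLT_total (R := R) (c := c) (Sum.inl_injective.ne hxz)
  have h4 : ¬ circOfLT (cutLT R c) (Sum.inl x) (Sum.inl z) (Sum.inl y) :=
    fun h' => R.asymm _ _ _ h (rel_of_circ h')
  unfold circOfLT at h4 ⊢
  grind [cutLT_trans]

variable (R c)

theorem continuous_cutProj :
    @Continuous (X ⊕ Unit) X (rayTopology (cutLT R c)) (intervalTopology R.rel)
      (cutProj c) := by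
  let _ := rayTopology (cutLT R c)
  have isOpen_gt (a : X ⊕ Unit) : IsOpen {y | cutLT R c a y} :=
    TopologicalSpace.isOpen_generateFrom_of_mem (Or.inl ⟨a, rfl⟩)
  have isOpen_lt (a : X ⊕ Unit) : IsOpen {y | cutLT R c y a} :=
    TopologicalSpace.isOpen_generateFrom_of_mem (Or.inr ⟨a, rfl⟩)
  have isOpen_arc (a b : X ⊕ Unit) : IsOpen {y | circOfLT (cutLT R c) a y b} :=
    ((isOpen_gt a).inter (isOpen_lt b)).union
      (((isOpen_lt b).inter isOpen_const).union (isOpen_const.inter (isOpen_gt a)))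
  refine continuous_generateFrom_iff.2 ?_
  rintro _ ⟨a, b, hab, rfl⟩
  by_cases hb : b = c
  · subst hb
    convert isOpen_arc (Sum.inl a) (Sum.inr ()) using 1
    ext (x | u)
    · simpa [cutProj, rel_iff_circOfLT (c := b), circOfLT] using fun _ => cutLT_base hab
    · simp [cutProj, circOfLT, R.not_rel_right]
  · convert isOpen_arc (Sum.inl a) (Sum.inl b) using 1
    ext (x | u)
    · simp [cutProj, rel_iff_circOfLT (c := c)]
    · simp [cutProj, rel_iff_circOfLT (c := c), circOfLT, cutLT_base hb]

theorem isCOP_cutProj : IsCOP (circOfLT (cutLT R c)) R.rel (cutProj c) := by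
  constructor
  · rintro (x | x) (y | y) (z | z) h hxy hyz hxz <;>
      simp_all [cutProj, rel_iff_circOfLT (c := c), circOfLT, cutLT_base, Ne.symm]
  · rintro (x | x) (z | z) h
    · obtain rfl : x = z := h
      left
      rintro y ((rfl | rfl) | hy)
      · rfl
      · rfl
      · have := R.cutLT_irrefl c (Sum.inl x)
        simp only [circOfLT, Set.mem_ofPred_eq] at hy
        grind [cutLT_trans]
    · obtain rfl : x = c := h
      right
      rintro y ((rfl | rfl) | hy)
      · rfl
      · rfl
      · simp [circOfLT] at hy
    · obtain rfl : c = z := h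
      left
      rintro y ((rfl | rfl) | hy)
      · rfl
      · rfl
      · simp [circOfLT] at hy
    · left
      rintro y ((rfl | rfl) | hy)
      · rfl
      · rfl
      · simp [circOfLT] at hy

theorem compactSpace_cut (h : @CompactSpace X (intervalTopology R.rel)) :
    @CompactSpace (X ⊕ Unit) (rayTopology (cutLT R c)) := by
  let _ := intervalTopology R.rel
  let _ := rayTopology (cutLT R c)
  refine compactSpace_generateFrom rfl fun P hP hcover => ?_
  let up (a : X ⊕ Unit) : Set (X ⊕ Unit) := {y | cutLT R c a y}
  let down (b : X ⊕ Unit) : Set (X ⊕ Unit) := {y | cutLT R c y b}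
  by_cases hex : ∃ a b, up a ∈ P ∧ down b ∈ P ∧ cutLT R c a b
  · obtain ⟨a, b, ha, hb, hab⟩ := hex
    refine ⟨{up a, down b}, Set.pair_subset ha hb, Set.toFinite _, Set.eq_univ_of_forall fun y => ?_⟩
    rw [Set.sUnion_pair]
    by_cases hay : a = y
    · exact Or.inr (hay ▸ hab)
    · exact (cutLT_total hay).imp id fun hya => cutLT_trans hya hab
  exfalso
  push Not at hex
  have covered (y : X ⊕ Unit) :
      (∃ a, up a ∈ P ∧ cutLT R c a y) ∨ ∃ b, down b ∈ P ∧ cutLT R c y b := by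
    obtain ⟨s, hs, hy⟩ := Set.mem_sUnion.1 (hcover ▸ Set.mem_univ y)
    rcases hP hs with ⟨a, rfl⟩ | ⟨b, rfl⟩
    · exact Or.inl ⟨a, hs, hy⟩
    · exact Or.inr ⟨b, hs, hy⟩
  have lt_of_mem {a b : X ⊕ Unit} (ha : up a ∈ P) (hb : down b ∈ P) : cutLT R c b a := by
    have hne : b ≠ a := by
      rintro rfl
      rcases covered b with ⟨a, ha', hab⟩ | ⟨b', hb', hbb⟩
      · exact hex _ _ ha' hb hab
      · exact hex _ _ ha hb' hbb
    exact (cutLT_total hne).resolve_right (hex a b ha hb)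
  obtain ⟨a₀, ha₀⟩ : ∃ a : X, up (Sum.inl a) ∈ P := by
    rcases covered (Sum.inr ()) with ⟨a | a, ha, h'⟩ | ⟨b, hb, h'⟩
    · exact ⟨a, ha⟩
    · simp at h'
    · simp at h'
  obtain ⟨b₀, hb₀⟩ : ∃ b : X, down (Sum.inl b) ∈ P := by
    rcases covered (Sum.inl c) with ⟨a, ha, h'⟩ | ⟨b | b, hb, h'⟩
    · simp at h'
    · exact ⟨b, hb⟩
    · simpa using lt_of_mem ha₀ hb
  let ι := {p : X × X // up (Sum.inl p.1) ∈ P ∧ down (Sum.inl p.2) ∈ P}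
  let U (p : ι) : Set X := {x | R.rel p.1.1 x p.1.2}
  have mem_U (p : ι) (x : X) : x ∈ U p ↔
      cutLT R c (Sum.inl p.1.1) (Sum.inl x) ∨ cutLT R c (Sum.inl x) (Sum.inl p.1.2) := by
    have hlt := lt_of_mem p.2.1 p.2.2
    simp only [U, Set.mem_ofPred_eq, rel_iff_circOfLT (c := c), circOfLT]
    tauto
  have hU_open (p : ι) : IsOpen (U p) := by
    refine TopologicalSpace.isOpen_generateFrom_of_mem ⟨p.1.1, p.1.2, fun heq => ?_, rfl⟩
    exact R.cutLT_irrefl c _ (heq ▸ lt_of_mem p.2.1 p.2.2)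
  have hU_cover : Set.univ ⊆ ⋃ p, U p := by
    intro x _
    rw [Set.mem_iUnion]
    rcases covered (Sum.inl x) with ⟨a | a, ha, hx⟩ | ⟨b | b, hb, hx⟩
    · exact ⟨⟨(a, b₀), ha, hb₀⟩, (mem_U _ _).2 (Or.inl hx)⟩
    · simp at hx
    · exact ⟨⟨(a₀, b), ha₀, hb⟩, (mem_U _ _).2 (Or.inr hx)⟩
    · simpa using lt_of_mem ha₀ hb
  have hU_dir : Directed (· ⊆ ·) U := by
    rintro ⟨⟨a, b⟩, ha, hb⟩ ⟨⟨a', b'⟩, ha', hb'⟩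
    obtain ⟨a'', ha'', haa⟩ : ∃ a'', up (Sum.inl a'') ∈ P ∧
        up (Sum.inl a) ⊆ up (Sum.inl a'') ∧ up (Sum.inl a') ⊆ up (Sum.inl a'') := by
      by_cases haa : (Sum.inl a : X ⊕ Unit) = Sum.inl a'
      · exact ⟨a, ha, subset_rfl, haa ▸ subset_rfl⟩
      · rcases cutLT_total (R := R) (c := c) haa with hlt | hlt
        · exact ⟨a, ha, subset_rfl, fun _ => cutLT_trans hlt⟩
        · exact ⟨a', ha', fun _ => cutLT_trans hlt, subset_rfl⟩
    obtain ⟨b'', hb'', hbb⟩ : ∃ b'', down (Sum.inl b'') ∈ P ∧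
        down (Sum.inl b) ⊆ down (Sum.inl b'') ∧ down (Sum.inl b') ⊆ down (Sum.inl b'') := by
      by_cases hbb : (Sum.inl b : X ⊕ Unit) = Sum.inl b'
      · exact ⟨b, hb, subset_rfl, hbb ▸ subset_rfl⟩
      · rcases cutLT_total (R := R) (c := c) hbb with hlt | hlt
        · exact ⟨b', hb', fun _ h' => cutLT_trans h' hlt, subset_rfl⟩
        · exact ⟨b, hb, subset_rfl, fun _ h' => cutLT_trans h' hlt⟩
    refine ⟨⟨(a'', b''), ha'', hb''⟩, fun x hx => ?_, fun x hx => ?_⟩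
    · exact (mem_U _ _).2 (((mem_U _ _).1 hx).imp (@haa.1 (Sum.inl x)) (@hbb.1 (Sum.inl x)))
    · exact (mem_U _ _).2 (((mem_U _ _).1 hx).imp (@haa.2 (Sum.inl x)) (@hbb.2 (Sum.inl x)))
  have : Nonempty ι := ⟨⟨(a₀, b₀), ha₀, hb₀⟩⟩
  obtain ⟨p, hp⟩ := isCompact_univ.elim_directed_cover U hU_open hU_cover hU_dir
  exact R.not_rel_left _ _ (hp (Set.mem_univ p.1.1))

end CircularOrderRel

/-- For a circularly ordered set `(X,R)` and `c ∈ X`, the cut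
space `X(c)` with the relation `cutLT` satisfies: (a) `cutLT` is a strict
linear order; (b) the projection `q : X(c) → X` is continuous from the order
topology of `X(c)` to the interval topology of `R`; (c) `q` is c-order
preserving for the circular order induced by the linear order of `X(c)`;
(d) if the interval topology of `R` is compact then so is `X(c)`. -/
theorem cut_space_properties {X : Type*} (R : CircularOrderRel X) (c : X) :
    (∀ x : X ⊕ Unit, ¬ cutLT R c x x) ∧
    (∀ x y z : X ⊕ Unit, cutLT R c x y → cutLT R c y z → cutLT R c x z) ∧
    (∀ x y : X ⊕ Unit, x ≠ y → cutLT R c x y ∨ cutLT R c y x) ∧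
    @Continuous (X ⊕ Unit) X (rayTopology (cutLT R c)) (intervalTopology R.rel)
      (cutProj c) ∧
    IsCOP (circOfLT (cutLT R c)) R.rel (cutProj c) ∧
    (@CompactSpace X (intervalTopology R.rel) →
      @CompactSpace (X ⊕ Unit) (rayTopology (cutLT R c))) := by
  exact ⟨R.cutLT_irrefl c, fun _ _ _ => CircularOrderRel.cutLT_trans,
    fun _ _ => CircularOrderRel.cutLT_total, R.continuous_cutProj c, R.isCOP_cutProj c,
    R.compactSpace_cut c⟩
end
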